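/- arXiv:1306.5553 — 11 statements merged into one kernel-verified Lean document; each statement's English description precedes it below -/
import Mathlib

section
/- Let R be an integral domain. Then the family of constructible right ideals of the ax+b-semigroup R⋊R× is exactly J_λ(R⋊R×) = { (r+I) × (I∖{0}) : r ∈ R, I ∈ I(R) } ∪ {∅}. -/
/-- The family of constructible ring-theoretic ideals
`I(R) = { c⁻¹(a₁R ∩ … ∩ aₙR) : n ≥ 1, a₁,…,aₙ,c ∈ R∖{0} }`. -/
def cI (R : Type*) [CommRing R] : Set (Set R) :=
  { I | ∃ (n : ℕ) (a : Fin (n + 1) → R) (c : R), (∀ i, a i ≠ 0) ∧ c ≠ 0 ∧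
      I = { r : R | ∀ i, ∃ t : R, c * r = a i * t } }

/-- The `ax+b`-semigroup `R ⋊ R×` over an integral domain `R`,
modelled as pairs `(b, a)` with `a ≠ 0`. -/
abbrev AxB (R : Type*) [CommRing R] := R × { a : R // a ≠ 0 }

/-- Multiplication `(b,a)(x,w) = (b + a·x, a·w)` on the `ax+b`-semigroup. -/
def axbMul {R : Type*} [CommRing R] [IsDomain R] (p q : AxB R) : AxB R :=
  (p.1 + p.2.1 * q.1, ⟨p.2.1 * q.2.1, mul_ne_zero p.2.2 q.2.2⟩)

/-- `constrL [(q₁,p₁), …, (qₙ,pₙ)] = q₁⁻¹p₁ ⋯ qₙ⁻¹pₙ P`, where `P = R ⋊ R×`. -/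
def constrL {R : Type*} [CommRing R] [IsDomain R] : List (AxB R × AxB R) → Set (AxB R)
  | [] => Set.univ
  | (q, p) :: l => { y | axbMul q y ∈ axbMul p '' constrL l }

/-- The family of constructible right ideals
`J_λ(P) = { q₁⁻¹p₁ ⋯ qₙ⁻¹pₙ P : n ≥ 1, pᵢ, qᵢ ∈ P } ∪ {∅}` for `P = R ⋊ R×`. -/
def JLambda (R : Type*) [CommRing R] [IsDomain R] : Set (Set (AxB R)) :=
  insert ∅ { X | ∃ l : List (AxB R × AxB R), l ≠ [] ∧ X = constrL l }

/-- The set `(r + I) × (I ∖ {0})` inside the `ax+b`-semigroup. -/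
def axbCoset {R : Type*} [CommRing R] (r : R) (I : Set R) : Set (AxB R) :=
  { p : AxB R | p.1 ∈ (fun y => r + y) '' I ∧ p.2.1 ∈ I }

theorem mem_axbCoset {R : Type*} [CommRing R] {r : R} {I : Set R} {p : AxB R} :
    p ∈ axbCoset r I ↔ p.1 - r ∈ I ∧ p.2.1 ∈ I := by
  simp only [axbCoset, Set.mem_ofPred_eq, Set.mem_image]
  refine and_congr_left fun _ => ⟨?_, fun h => ⟨_, h, by ring⟩⟩
  rintro ⟨y, hy, h⟩
  rwa [← h, add_sub_cancel_left]

theorem mem_cI {R : Type*} [CommRing R] {I : Set R} :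
    I ∈ cI R ↔ ∃ (n : ℕ) (a : Fin (n + 1) → R) (c : R), (∀ i, a i ≠ 0) ∧ c ≠ 0 ∧
      I = { r : R | ∀ i, a i ∣ c * r } :=
  Iff.rfl

theorem univ_mem_cI (R : Type*) [CommRing R] [IsDomain R] : (Set.univ : Set R) ∈ cI R :=
  mem_cI.2 ⟨0, fun _ => 1, 1, by simp, one_ne_zero, by simp⟩

theorem sub_mem_of_mem_cI {R : Type*} [CommRing R] {I : Set R} (hI : I ∈ cI R) {x y : R}
    (hx : x ∈ I) (hy : y ∈ I) : x - y ∈ I := by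
  obtain ⟨n, a, c, -, -, rfl⟩ := mem_cI.1 hI
  intro i
  rw [mul_sub]
  exact dvd_sub (hx i) (hy i)

theorem add_mem_of_mem_cI {R : Type*} [CommRing R] {I : Set R} (hI : I ∈ cI R) {x y : R}
    (hx : x ∈ I) (hy : y ∈ I) : x + y ∈ I := by
  obtain ⟨n, a, c, -, -, rfl⟩ := mem_cI.1 hI
  intro i
  rw [mul_add]
  exact dvd_add (hx i) (hy i)

/-- `I(R)` is closed under `I ↦ c⁻¹(aI)`. -/
theorem preimage_mul_image_mem_cI {R : Type*} [CommRing R] [IsDomain R] {I : Set R}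
    (hI : I ∈ cI R) {a c : R} (ha : a ≠ 0) (hc : c ≠ 0) :
    { x : R | ∃ y ∈ I, c * x = a * y } ∈ cI R := by
  obtain ⟨n, s, d, hs, hd, rfl⟩ := mem_cI.1 hI
  refine mem_cI.2 ⟨n + 1, Fin.cons (d * a) fun i => a * s i, d * c, ?_, mul_ne_zero hd hc, ?_⟩
  · exact Fin.cases (mul_ne_zero hd ha) fun i => mul_ne_zero ha (hs i)
  ext x
  simp only [Set.mem_ofPred_eq, Fin.forall_fin_succ (n := n + 1), Fin.cons_zero, Fin.cons_succ,
    mul_assoc d, mul_dvd_mul_iff_left hd]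
  constructor
  · rintro ⟨y, hy, h⟩
    refine ⟨⟨y, h⟩, fun i => ?_⟩
    rw [h, mul_left_comm]
    exact mul_dvd_mul_left a (hy i)
  · rintro ⟨⟨y, h⟩, hy⟩
    refine ⟨y, fun i => ?_, h⟩
    have := hy i
    rwa [h, mul_left_comm, mul_dvd_mul_iff_left ha] at this

theorem mem_constrL_cons {R : Type*} [CommRing R] [IsDomain R] {q p : AxB R}
    {l : List (AxB R × AxB R)} {y : AxB R} :
    y ∈ constrL ((q, p) :: l) ↔ ∃ z ∈ constrL l,
      p.1 + p.2.1 * z.1 = q.1 + q.2.1 * y.1 ∧ p.2.1 * z.2.1 = q.2.1 * y.2.1 := by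
  simp only [constrL, Set.mem_ofPred_eq, Set.mem_image, axbMul, Prod.mk.injEq, Subtype.mk.injEq]

theorem constrL_eq_empty_or_axbCoset {R : Type*} [CommRing R] [IsDomain R]
    (l : List (AxB R × AxB R)) :
    constrL l = ∅ ∨ ∃ (r : R) (I : Set R), I ∈ cI R ∧ constrL l = axbCoset r I := by
  induction l with
  | nil =>
    refine .inr ⟨0, Set.univ, univ_mem_cI R, ?_⟩
    ext p
    simp [constrL, mem_axbCoset]
  | cons x l ih =>
    obtain ⟨q, p⟩ := x
    rcases Set.eq_empty_or_nonempty (constrL ((q, p) :: l)) with h | ⟨y₀, hy₀⟩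
    · exact .inl h
    right
    obtain ⟨z₀, hz₀, h₁, -⟩ := mem_constrL_cons.1 hy₀
    rcases ih with h | ⟨r, I, hI, h⟩
    · simp [h] at hz₀
    rw [h, mem_axbCoset] at hz₀
    refine ⟨y₀.1, _, preimage_mul_image_mem_cI hI p.2.2 q.2.2, ?_⟩
    ext y
    rw [mem_constrL_cons, mem_axbCoset, h]
    constructor
    · rintro ⟨z, hz, h₃, h₄⟩
      rw [mem_axbCoset] at hz
      refine ⟨⟨z.1 - z₀.1, ?_, by linear_combination h₁ - h₃⟩, z.2.1, hz.2, h₄.symm⟩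
      simpa using sub_mem_of_mem_cI hI hz.1 hz₀.1
    · rintro ⟨⟨u, hu, h₃⟩, v, hv, h₄⟩
      have hv0 : v ≠ 0 := by
        rintro rfl
        exact mul_ne_zero q.2.2 y.2.2 (by simpa using h₄)
      refine ⟨(z₀.1 + u, ⟨v, hv0⟩), mem_axbCoset.2 ⟨?_, hv⟩, ?_, h₄.symm⟩
      · simpa [add_sub_right_comm] using add_mem_of_mem_cI hI hz₀.1 hu
      · linear_combination h₁ - h₃

theorem exists_constrL_eq_forall_dvd {R : Type*} [CommRing R] [IsDomain R] (s : List R)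
    (hs : ∀ a ∈ s, a ≠ 0) :
    ∃ l : List (AxB R × AxB R), constrL l = { p | ∀ a ∈ s, a ∣ p.1 ∧ a ∣ p.2.1 } := by
  induction s with
  | nil => exact ⟨[], by simp [constrL]⟩
  | cons a s ih =>
    obtain ⟨l, hl⟩ := ih fun b hb => hs b (List.mem_cons_of_mem a hb)
    have ha : a ≠ 0 := hs a List.mem_cons_self
    let e : AxB R := (0, ⟨1, one_ne_zero⟩)
    let g : AxB R := (0, ⟨a, ha⟩)
    refine ⟨(e, g) :: (g, e) :: l, ?_⟩
    ext y
    simp only [mem_constrL_cons, hl, Set.mem_ofPred_eq, List.forall_mem_cons, e, g, zero_add,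
      one_mul]
    constructor
    · rintro ⟨z, ⟨w, hw, h₁, h₂⟩, h₃, h₄⟩
      rw [← h₃, ← h₄]
      refine ⟨⟨dvd_mul_right _ _, dvd_mul_right _ _⟩, ?_⟩
      rwa [← h₁, ← h₂]
    · rintro ⟨⟨⟨u, hu⟩, v, hv⟩, h⟩
      have hv0 : v ≠ 0 := by
        rintro rfl
        exact y.2.2 (by simpa using hv)
      exact ⟨(u, ⟨v, hv0⟩), ⟨y, h, hu, hv⟩, hu.symm, hv.symm⟩

theorem exists_constrL_eq_axbCoset {R : Type*} [CommRing R] [IsDomain R] (r : R) {I : Set R}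
    (hI : I ∈ cI R) : ∃ l : List (AxB R × AxB R), l ≠ [] ∧ axbCoset r I = constrL l := by
  obtain ⟨n, a, c, ha, hc, rfl⟩ := mem_cI.1 hI
  obtain ⟨l, hl⟩ := exists_constrL_eq_forall_dvd (List.ofFn a) (List.forall_mem_ofFn_iff.2 ha)
  refine ⟨((-(c * r), ⟨c, hc⟩), (0, ⟨1, one_ne_zero⟩)) :: l, List.cons_ne_nil _ _, ?_⟩
  ext y
  simp only [mem_axbCoset, mem_constrL_cons, hl, Set.mem_ofPred_eq, List.forall_mem_ofFn_iff,
    zero_add, one_mul]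
  constructor
  · rintro ⟨h₁, h₂⟩
    exact ⟨(c * (y.1 - r), ⟨c * y.2.1, mul_ne_zero hc y.2.2⟩), fun i => ⟨h₁ i, h₂ i⟩,
      by ring, rfl⟩
  · rintro ⟨z, hz, h₁, h₂⟩
    have h₃ : z.1 = c * (y.1 - r) := by rw [h₁]; ring
    rw [← h₂, ← h₃]
    exact ⟨fun i => (hz i).1, fun i => (hz i).2⟩

/-- The constructible right ideals of `R ⋊ R×` are exactly the sets
`(r + I) × (I ∖ {0})` with `r ∈ R`, `I ∈ I(R)`, together with `∅`. -/
theorem constructible_right_ideals_of_axb (R : Type*) [CommRing R] [IsDomain R] :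
    JLambda R = insert ∅
      { X | ∃ (r : R) (I : Set R), I ∈ cI R ∧
        X = { p : AxB R | p.1 ∈ (fun y => r + y) '' I ∧ p.2.1 ∈ I } } := by
  ext X
  constructor
  · rintro (rfl | ⟨l, -, rfl⟩)
    · exact Set.mem_insert _ _
    · exact constrL_eq_empty_or_axbCoset l
  · rintro (rfl | ⟨r, I, hI, rfl⟩)
    · exact Set.mem_insert _ _
    · exact .inr (exists_constrL_eq_axbCoset r hI)
end

section
/- Let R be an integral domain. Then the family of constructible left ideals of the ax+b-semigroup R⋊R× is exactly J_ρ(R⋊R×) = { R × (I∖{0}) : I ∈ I(R) } ∪ {∅}. -/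
/-- `constrR [(p₁,q₁), …, (pₙ,qₙ)] = P pₙqₙ⁻¹ ⋯ p₁q₁⁻¹`, where `P = R ⋊ R×`. -/
def constrR {R : Type*} [CommRing R] [IsDomain R] : List (AxB R × AxB R) → Set (AxB R)
  | [] => Set.univ
  | (p, q) :: l => { y | axbMul y q ∈ (fun x => axbMul x p) '' constrR l }

/-- The family of constructible left ideals
`J_ρ(P) = { P pₙqₙ⁻¹ ⋯ p₁q₁⁻¹ : n ≥ 1, pᵢ, qᵢ ∈ P } ∪ {∅}` for `P = R ⋊ R×`. -/
def JRho (R : Type*) [CommRing R] [IsDomain R] : Set (Set (AxB R)) :=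
  insert ∅ { X | ∃ l : List (AxB R × AxB R), l ≠ [] ∧ X = constrR l }

theorem constrR_cons_of_eq {R : Type*} [CommRing R] [IsDomain R] {l : List (AxB R × AxB R)}
    {I : Set R} (h : constrR l = { y : AxB R | y.2.1 ∈ I }) (p q : AxB R) :
    constrR ((p, q) :: l) =
      { y : AxB R | y.2.1 ∈ { r : R | ∃ s ∈ I, q.2.1 * r = p.2.1 * s } } := by
  ext y
  simp only [constrR, h, Set.mem_ofPred_eq, Set.mem_image]
  constructor
  · rintro ⟨x, hx, hxy⟩
    refine ⟨x.2.1, hx, ?_⟩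
    have h2 : x.2.1 * p.2.1 = y.2.1 * q.2.1 := congrArg (fun z : AxB R => z.2.1) hxy
    linear_combination -h2
  · rintro ⟨s, hs, hsy⟩
    have hs0 : s ≠ 0 := by
      rintro rfl
      exact mul_ne_zero q.2.2 y.2.2 (by simpa using hsy)
    refine ⟨(y.1 + y.2.1 * q.1 - s * p.1, ⟨s, hs0⟩), hs, ?_⟩
    refine Prod.ext ?_ (Subtype.ext ?_)
    · simp [axbMul]
    · simp only [axbMul]
      linear_combination -hsy

theorem exists_constrR_eq_forall_dvd {R : Type*} [CommRing R] [IsDomain R] (n : ℕ)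
    (a : Fin n → R) (ha : ∀ i, a i ≠ 0) :
    ∃ l : List (AxB R × AxB R), constrR l = { y : AxB R | y.2.1 ∈ { r : R | ∀ i, a i ∣ r } } := by
  induction n with
  | zero => exact ⟨[], by simp [constrR]⟩
  | succ n ih =>
    obtain ⟨l, hl⟩ := ih (fun i => a i.succ) (fun i => ha _)
    have h₁ := constrR_cons_of_eq hl (0, ⟨1, one_ne_zero⟩) (0, ⟨a 0, ha 0⟩)
    have h₂ := constrR_cons_of_eq h₁ (0, ⟨a 0, ha 0⟩) (0, ⟨1, one_ne_zero⟩)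
    refine ⟨_, h₂.trans ?_⟩
    ext y
    simp only [Set.mem_ofPred_eq, one_mul, Fin.forall_fin_succ]
    constructor
    · rintro ⟨s, ⟨t, ht, hst⟩, hy⟩
      exact ⟨⟨s, hy⟩, fun i => by rw [hy, hst]; exact ht i⟩
    · rintro ⟨⟨s, hs⟩, hy⟩
      exact ⟨s, ⟨_, hy, hs.symm⟩, hs⟩

theorem exists_mem_cI_constrR_eq {R : Type*} [CommRing R] [IsDomain R]
    (l : List (AxB R × AxB R)) :
    ∃ I ∈ cI R, constrR l = { y : AxB R | y.2.1 ∈ I } := by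
  induction l with
  | nil =>
    exact ⟨Set.univ, ⟨0, fun _ => 1, 1, by simp, one_ne_zero, by simp⟩, by simp [constrR]⟩
  | cons pq l ih =>
    obtain ⟨p, q⟩ := pq
    obtain ⟨I, ⟨n, a, c, ha, hc, rfl⟩, hl⟩ := ih
    refine ⟨_, ?_, constrR_cons_of_eq hl p q⟩
    refine ⟨n + 1, Fin.cons (c * p.2.1) (fun i => p.2.1 * a i), c * q.2.1, ?_,
      mul_ne_zero hc q.2.2, ?_⟩
    · refine Fin.cases (mul_ne_zero hc p.2.2) (fun i => ?_)
      simpa using ⟨p.2.2, ha i⟩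
    · ext r
      simp only [Set.mem_ofPred_eq]
      rw [Fin.forall_fin_succ]
      simp only [Fin.cons_zero, Fin.cons_succ]
      constructor
      · rintro ⟨s, hs, hr⟩
        refine ⟨⟨s, by linear_combination c * hr⟩, fun i => ?_⟩
        obtain ⟨t, ht⟩ := hs i
        exact ⟨t, by linear_combination c * hr + p.2.1 * ht⟩
      · rintro ⟨⟨s, hs⟩, h⟩
        refine ⟨s, fun i => ?_, mul_left_cancel₀ hc (by linear_combination hs)⟩
        obtain ⟨t, ht⟩ := h i
        exact ⟨t, mul_left_cancel₀ p.2.2 (by linear_combination ht - hs)⟩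

/-- The constructible left ideals of `R ⋊ R×` are exactly the sets
`R × (I ∖ {0})` with `I ∈ I(R)`, together with `∅`. -/
theorem constructible_left_ideals_of_axb (R : Type*) [CommRing R] [IsDomain R] :
    JRho R = insert ∅
      { X | ∃ I : Set R, I ∈ cI R ∧ X = { p : AxB R | p.2.1 ∈ I } } := by
  refine congrArg (insert ∅) (Set.ext fun X => ⟨?_, ?_⟩)
  · rintro ⟨l, -, rfl⟩
    exact exists_mem_cI_constrR_eq l
  · rintro ⟨_, ⟨n, a, c, ha, hc, rfl⟩, rfl⟩
    obtain ⟨l, hl⟩ := exists_constrR_eq_forall_dvd (n + 1) a ha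
    refine ⟨_ :: l, List.cons_ne_nil _ _, Eq.symm <|
      (constrR_cons_of_eq hl (0, ⟨1, one_ne_zero⟩) (0, ⟨c, hc⟩)).trans ?_⟩
    ext y
    simp [dvd_def]
end

section
/- Let R be an integral domain. The following are equivalent: (i) the family J_λ(R⋊R×) of constructible right ideals of R⋊R× is independent; (ii) the family J_ρ(R⋊R×) of constructible left ideals of R⋊R× is independent; (iii) the family I(R) of constructible ring-theoretic ideals of R is independent. -/
/-- A family `F` of subsets is independent if whenever `X, X₁, …, Xₙ ∈ F`
satisfy `X = X₁ ∪ … ∪ Xₙ`, then `X = Xᵢ` for some `i`. -/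
def IsIndependentFamily {α : Type*} (F : Set (Set α)) : Prop :=
  ∀ (X : Set α) (n : ℕ) (Xs : Fin (n + 1) → Set α),
    X ∈ F → (∀ i, Xs i ∈ F) → X = ⋃ i, Xs i → ∃ i, X = Xs i

/-- Independence phrased with finite nonempty sets of members instead of finite tuples. -/
theorem isIndependentFamily_iff {α : Type*} {F : Set (Set α)} :
    IsIndependentFamily F ↔ ∀ X ∈ F, ∀ S : Set (Set α), S.Finite → S.Nonempty → S ⊆ F →
      X = ⋃₀ S → X ∈ S := by
  constructor
  · intro h X hX S hS hne hSF hXS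
    obtain ⟨n, f, -, rfl⟩ := hS.fin_param
    obtain ⟨_, i, rfl⟩ := hne
    obtain ⟨n, rfl⟩ := Nat.exists_eq_succ_of_ne_zero (Fin.pos i).ne'
    obtain ⟨j, hj⟩ := h X n f hX (fun i => hSF ⟨i, rfl⟩) (by rw [hXS, Set.sUnion_range])
    exact ⟨j, hj.symm⟩
  · intro h X n Xs hX hXs hU
    obtain ⟨i, hi⟩ := h X hX (Set.range Xs) (Set.finite_range _) (Set.range_nonempty _)
      (by rintro _ ⟨i, rfl⟩; exact hXs i) (by rw [hU, Set.sUnion_range])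
    exact ⟨i, hi.symm⟩

section Constructible

variable {R : Type*} [CommRing R]

/-- The ideal `e⁻¹(cI)`. -/
def mulQuot (e c : R) (I : Ideal R) : Ideal R :=
  (Submodule.map (LinearMap.mulLeft R c) I).comap (LinearMap.mulLeft R e)

theorem mem_mulQuot {e c : R} {I : Ideal R} {r : R} :
    r ∈ mulQuot e c I ↔ ∃ s ∈ I, e * r = c * s := by
  simp [mulQuot, eq_comm]

/-- The ideals obtained from `R` by iterating `I ↦ e⁻¹(cI)` with `e, c ≠ 0`. -/
inductive IsConstructibleIdeal : Ideal R → Prop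
  | top : IsConstructibleIdeal ⊤
  | mulQuot (e c : R) (he : e ≠ 0) (hc : c ≠ 0) (I : Ideal R) (hI : IsConstructibleIdeal I) :
      IsConstructibleIdeal (mulQuot e c I)

theorem exists_isConstructibleIdeal_of_mem_cI {X : Set R} (hX : X ∈ cI R) :
    ∃ I : Ideal R, IsConstructibleIdeal I ∧ X = I := by
  obtain ⟨n, a, c, ha, hc, rfl⟩ := hX
  induction n generalizing c with
  | zero =>
    refine ⟨mulQuot c (a 0) ⊤, .mulQuot _ _ hc (ha 0) _ .top, ?_⟩
    ext r
    simp [mem_mulQuot]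
  | succ n ih =>
    obtain ⟨J, hJ, hJeq⟩ := ih (fun i => a i.succ) (a 0) (fun i => ha _) (ha 0)
    have hmem : ∀ s, s ∈ J ↔ ∀ i : Fin (n + 1), ∃ t, a 0 * s = a i.succ * t := fun s => by
      rw [← SetLike.mem_coe, ← hJeq]; rfl
    refine ⟨mulQuot c (a 0) J, .mulQuot _ _ hc (ha 0) _ hJ, ?_⟩
    ext r
    simp only [SetLike.mem_coe, mem_mulQuot, Set.mem_ofPred_eq, hmem]
    rw [Fin.forall_fin_succ]
    constructor
    · rintro ⟨⟨s, hs⟩, h⟩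
      exact ⟨s, fun i => hs ▸ h i, hs⟩
    · rintro ⟨s, h, hs⟩
      exact ⟨⟨s, hs⟩, fun i => hs ▸ h i⟩

/-- The right ideal `(b + I) × I×` of `R ⋊ R×`. -/
def cosetBox (I : Ideal R) (b : R) : Set (AxB R) := {p | p.1 - b ∈ I ∧ p.2.1 ∈ I}

/-- The left ideal `R × I×` of `R ⋊ R×`. -/
def fullBox (I : Ideal R) : Set (AxB R) := {p | p.2.1 ∈ I}

theorem le_of_cosetBox_subset {I J : Ideal R} {b d : R} (h : cosetBox I b ⊆ cosetBox J d) :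
    I ≤ J := by
  intro x hx
  by_cases hx0 : x = 0
  · simp [hx0]
  · exact (h (show ((b, ⟨x, hx0⟩) : AxB R) ∈ cosetBox I b by simp [cosetBox, hx])).2

theorem le_of_fullBox_subset {I J : Ideal R} (h : fullBox I ⊆ fullBox J) : I ≤ J := by
  intro x hx
  by_cases hx0 : x = 0
  · simp [hx0]
  · exact h (show ((0, ⟨x, hx0⟩) : AxB R) ∈ fullBox I from hx)

theorem cosetBox_eq_of_sub_mem {I : Ideal R} {b d : R} (h : b - d ∈ I) :
    cosetBox I b = cosetBox I d := by
  ext p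
  have : p.1 - d = (p.1 - b) + (b - d) := by ring
  simp only [cosetBox, Set.mem_ofPred_eq, this, I.add_mem_iff_left h]

open scoped Pointwise in
/-- By B. H. Neumann, in a finite cover by ideals those of infinite index are redundant. -/
theorem exists_mem_finite_quotient {I : Ideal R} {S : Set (Ideal R)} (hS : S.Finite)
    (hIS : ∀ x ∈ I, ∃ J ∈ S, x ∈ J) {x : R} (hx : x ∈ I) :
    ∃ J ∈ S, x ∈ J ∧
      (J.toAddSubgroup.addSubgroupOf I.toAddSubgroup).FiniteIndex := by
  classical
  have hcover : ⋃ J ∈ hS.toFinset, ((0 : I.toAddSubgroup) +ᵥ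
      (J.toAddSubgroup.addSubgroupOf I.toAddSubgroup : Set I.toAddSubgroup)) = Set.univ := by
    refine Set.eq_univ_of_forall fun y => ?_
    obtain ⟨J, hJ, hyJ⟩ := hIS y y.2
    simp only [zero_vadd, Set.mem_iUnion]
    exact ⟨J, hS.mem_toFinset.2 hJ, hyJ⟩
  have := AddSubgroup.leftCoset_cover_filter_FiniteIndex hcover
  have hxm := this.ge (Set.mem_univ (⟨x, hx⟩ : I.toAddSubgroup))
  simp only [zero_vadd, Set.mem_iUnion, Finset.mem_filter] at hxm
  obtain ⟨J, ⟨hJ, hfin⟩, hxJ⟩ := hxm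
  exact ⟨J, hS.mem_toFinset.1 hJ, hxJ, hfin⟩

variable [IsDomain R]

theorem IsConstructibleIdeal.exists_ne_zero {I : Ideal R} (hI : IsConstructibleIdeal I) :
    ∃ x ∈ I, x ≠ 0 := by
  induction hI with
  | top => exact ⟨1, trivial, one_ne_zero⟩
  | mulQuot e c he hc I hI ih =>
    obtain ⟨x, hx, hx0⟩ := ih
    exact ⟨c * x, mem_mulQuot.2 ⟨e * x, I.mul_mem_left _ hx, by ring⟩, mul_ne_zero hc hx0⟩

theorem IsConstructibleIdeal.coe_mem_cI {I : Ideal R} (hI : IsConstructibleIdeal I) :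
    (I : Set R) ∈ cI R := by
  induction hI with
  | top => exact ⟨0, fun _ => 1, 1, by simp, one_ne_zero, by ext; simp⟩
  | mulQuot e c he hc I hI ih =>
    obtain ⟨n, a, d, ha, hd, hI⟩ := ih
    refine ⟨n + 1, Fin.cons (d * c) (fun i => c * a i), d * e, ?_, mul_ne_zero hd he, ?_⟩
    · intro i
      refine Fin.cases ?_ (fun i => ?_) i
      · simpa using ⟨hd, hc⟩
      · simpa using ⟨hc, ha i⟩
    · ext r
      have hmem : ∀ s, s ∈ I ↔ ∀ i, ∃ t, d * s = a i * t := fun s => by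
        rw [← SetLike.mem_coe, hI]; rfl
      simp only [SetLike.mem_coe, mem_mulQuot, Set.mem_ofPred_eq, hmem]
      rw [Fin.forall_fin_succ (n := n + 1)]
      simp only [Fin.cons_zero, Fin.cons_succ]
      constructor
      · rintro ⟨s, hs, hr⟩
        refine ⟨⟨s, by linear_combination d * hr⟩, ?_⟩
        intro i
        obtain ⟨t, ht⟩ := hs i
        exact ⟨t, by linear_combination d * hr + c * ht⟩
      · rintro ⟨⟨s, hs⟩, h⟩
        refine ⟨s, fun i => ?_, mul_left_cancel₀ hd (by linear_combination hs)⟩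
        obtain ⟨t, ht⟩ := h i
        exact ⟨t, mul_left_cancel₀ hc (by linear_combination ht - hs)⟩

theorem mem_cI_iff {X : Set R} : X ∈ cI R ↔ ∃ I : Ideal R, IsConstructibleIdeal I ∧ X = I :=
  ⟨exists_isConstructibleIdeal_of_mem_cI, by rintro ⟨I, hI, rfl⟩; exact hI.coe_mem_cI⟩

theorem IsConstructibleIdeal.cosetBox_nonempty {I : Ideal R} (hI : IsConstructibleIdeal I)
    (b : R) : (cosetBox I b).Nonempty := by
  obtain ⟨x, hx, hx0⟩ := hI.exists_ne_zero
  exact ⟨(b, ⟨x, hx0⟩), by simp [cosetBox, hx]⟩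

theorem setOf_axbMul_mem_image_cosetBox {q p : AxB R} {I : Ideal R} {b x i : R} (hi : i ∈ I)
    (hx : q.1 + q.2.1 * x = p.1 + p.2.1 * (b + i)) :
    {y | axbMul q y ∈ axbMul p '' cosetBox I b} = cosetBox (mulQuot q.2.1 p.2.1 I) x := by
  ext ⟨y, v⟩
  simp only [cosetBox, mem_mulQuot, Set.mem_ofPred_eq, Set.mem_image, axbMul, Prod.mk.injEq,
    Subtype.mk.injEq]
  constructor
  · rintro ⟨⟨z, w⟩, ⟨hz, hw⟩, h1, h2⟩
    exact ⟨⟨z - b - i, I.sub_mem hz hi, by linear_combination -h1 - hx⟩, w.1, hw, h2.symm⟩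
  · rintro ⟨⟨s, hs, h1⟩, w, hw, h2⟩
    have hw0 : w ≠ 0 := by
      rintro rfl
      exact mul_ne_zero q.2.2 v.2 (by simpa using h2)
    refine ⟨(s + b + i, ⟨w, hw0⟩), ⟨?_, hw⟩, by linear_combination -h1 - hx, h2.symm⟩
    have : s + b + i - b = s + i := by ring
    simpa [this] using I.add_mem hs hi

theorem setOf_axbMul_mem_image_fullBox (p q : AxB R) (I : Ideal R) :
    {y | axbMul y q ∈ (fun x => axbMul x p) '' fullBox I} =
      fullBox (mulQuot q.2.1 p.2.1 I) := by
  ext ⟨y, v⟩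
  simp only [fullBox, mem_mulQuot, Set.mem_ofPred_eq, Set.mem_image, axbMul, Prod.mk.injEq,
    Subtype.mk.injEq]
  constructor
  · rintro ⟨⟨z, w⟩, hw, h1, h2⟩
    exact ⟨w.1, hw, by linear_combination -h2⟩
  · rintro ⟨w, hw, h2⟩
    have hw0 : w ≠ 0 := by
      rintro rfl
      exact mul_ne_zero q.2.2 v.2 (by simpa using h2)
    exact ⟨(y + v.1 * q.1 - w * p.1, ⟨w, hw0⟩), hw, by ring, by linear_combination -h2⟩

theorem constrL_eq_empty_or_cosetBox (l : List (AxB R × AxB R)) :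
    constrL l = ∅ ∨ ∃ I b, IsConstructibleIdeal I ∧ constrL l = cosetBox I b := by
  induction l with
  | nil => exact .inr ⟨⊤, 0, .top, by ext; simp [constrL, cosetBox]⟩
  | cons a l ih =>
    obtain ⟨q, p⟩ := a
    rcases ih with h | ⟨I, b, hI, h⟩
    · exact .inl (by simp [constrL, h])
    · refine (constrL ((q, p) :: l)).eq_empty_or_nonempty.imp_right ?_
      rintro ⟨y, hy⟩
      have hy' : axbMul q y ∈ axbMul p '' cosetBox I b := by rw [← h]; exact hy
      obtain ⟨z, hz, hzy⟩ := hy'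
      refine ⟨_, y.1, .mulQuot q.2.1 p.2.1 q.2.2 p.2.2 I hI, ?_⟩
      rw [constrL, h]
      refine setOf_axbMul_mem_image_cosetBox hz.1 ?_
      have := congrArg Prod.fst hzy
      simp only [axbMul] at this
      rw [← this]
      ring

theorem exists_constrL_eq_cosetBox {I : Ideal R} (hI : IsConstructibleIdeal I) (b : R) :
    ∃ l : List (AxB R × AxB R), l ≠ [] ∧ constrL l = cosetBox I b := by
  have key : ∃ l : List (AxB R × AxB R), constrL l = cosetBox I 0 := by
    induction hI with
    | top => exact ⟨[], by ext; simp [constrL, cosetBox]⟩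
    | mulQuot e c he hc I hI ih =>
      obtain ⟨l, hl⟩ := ih
      refine ⟨((0, ⟨e, he⟩), (0, ⟨c, hc⟩)) :: l, ?_⟩
      rw [constrL, hl]
      exact setOf_axbMul_mem_image_cosetBox I.zero_mem (by simp)
  obtain ⟨l, hl⟩ := key
  refine ⟨((0, ⟨1, one_ne_zero⟩), (b, ⟨1, one_ne_zero⟩)) :: l, by simp, ?_⟩
  rw [constrL, hl, setOf_axbMul_mem_image_cosetBox (x := b) I.zero_mem (by simp)]
  congr 1
  ext; simp [mem_mulQuot]

theorem mem_JLambda_iff {X : Set (AxB R)} :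
    X ∈ JLambda R ↔ X = ∅ ∨ ∃ I b, IsConstructibleIdeal I ∧ X = cosetBox I b := by
  refine or_congr_right' fun hX => ⟨?_, ?_⟩
  · rintro ⟨l, -, rfl⟩
    exact (constrL_eq_empty_or_cosetBox l).resolve_left hX
  · rintro ⟨I, b, hI, rfl⟩
    obtain ⟨l, hl, h⟩ := exists_constrL_eq_cosetBox hI b
    exact ⟨l, hl, h.symm⟩

theorem exists_constrR_eq_fullBox {I : Ideal R} (hI : IsConstructibleIdeal I) :
    ∃ l : List (AxB R × AxB R), l ≠ [] ∧ constrR l = fullBox I := by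
  have key : ∃ l : List (AxB R × AxB R), constrR l = fullBox I := by
    induction hI with
    | top => exact ⟨[], by ext; simp [constrR, fullBox]⟩
    | mulQuot e c he hc I hI ih =>
      obtain ⟨l, hl⟩ := ih
      refine ⟨((0, ⟨c, hc⟩), (0, ⟨e, he⟩)) :: l, ?_⟩
      rw [constrR, hl, setOf_axbMul_mem_image_fullBox]
  obtain ⟨l, hl⟩ := key
  refine ⟨((0, ⟨1, one_ne_zero⟩), (0, ⟨1, one_ne_zero⟩)) :: l, by simp, ?_⟩
  rw [constrR, hl, setOf_axbMul_mem_image_fullBox]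
  congr 1
  ext; simp [mem_mulQuot]

theorem exists_constrR_eq (l : List (AxB R × AxB R)) :
    ∃ I, IsConstructibleIdeal I ∧ constrR l = fullBox I := by
  induction l with
  | nil => exact ⟨⊤, .top, by ext; simp [constrR, fullBox]⟩
  | cons a l ih =>
    obtain ⟨I, hI, h⟩ := ih
    refine ⟨_, .mulQuot a.2.2.1 a.1.2.1 a.2.2.2 a.1.2.2 I hI, ?_⟩
    rw [constrR, h, setOf_axbMul_mem_image_fullBox]

theorem mem_JRho_iff {X : Set (AxB R)} :
    X ∈ JRho R ↔ X = ∅ ∨ ∃ I, IsConstructibleIdeal I ∧ X = fullBox I := by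
  refine or_congr_right ⟨?_, ?_⟩
  · rintro ⟨l, -, rfl⟩
    exact exists_constrR_eq l
  · rintro ⟨I, hI, rfl⟩
    obtain ⟨l, hl, h⟩ := exists_constrR_eq_fullBox hI
    exact ⟨l, hl, h.symm⟩

/-- Independence of the constructible ideals, phrased with finite sets of ideals. -/
theorem isIndependentFamily_cI_iff :
    IsIndependentFamily (cI R) ↔ ∀ I : Ideal R, IsConstructibleIdeal I → ∀ S : Set (Ideal R),
      S.Finite → (∀ J ∈ S, IsConstructibleIdeal J) → (∀ x, x ∈ I ↔ ∃ J ∈ S, x ∈ J) → I ∈ S := by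
  rw [isIndependentFamily_iff]
  constructor
  · intro h I hI S hS hSc hIS
    obtain ⟨J, hJ, -⟩ := (hIS 0).1 I.zero_mem
    obtain ⟨K, hK, hKI⟩ := h I hI.coe_mem_cI ((↑) '' S) (hS.image _) ⟨_, J, hJ, rfl⟩
      (by rintro _ ⟨K, hK, rfl⟩; exact (hSc K hK).coe_mem_cI) (by ext x; simp [hIS])
    rwa [← SetLike.coe_injective hKI]
  · intro h X hX S hS _ hSc hXS
    obtain ⟨I, hI, rfl⟩ := mem_cI_iff.1 hX
    refine h I hI ((↑) ⁻¹' S) (hS.preimage SetLike.coe_injective.injOn) ?_ ?_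
    · intro J hJ
      obtain ⟨K, hK, hKJ⟩ := mem_cI_iff.1 (hSc hJ)
      rwa [SetLike.coe_injective hKJ]
    · intro x
      rw [← SetLike.mem_coe, hXS]
      constructor
      · rintro ⟨Y, hY, hx⟩
        obtain ⟨K, hK, rfl⟩ := mem_cI_iff.1 (hSc hY)
        exact ⟨K, hY, hx⟩
      · rintro ⟨J, hJ, hx⟩
        exact ⟨J, hJ, hx⟩

theorem isIndependentFamily_JRho_iff :
    IsIndependentFamily (JRho R) ↔ IsIndependentFamily (cI R) := by
  rw [isIndependentFamily_cI_iff, isIndependentFamily_iff]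
  constructor
  · intro h I hI S hS hSc hIS
    obtain ⟨J, hJ, -⟩ := (hIS 0).1 I.zero_mem
    obtain ⟨K, hK, hKI⟩ := h (fullBox I) (mem_JRho_iff.2 (.inr ⟨I, hI, rfl⟩)) (fullBox '' S)
      (hS.image _) ⟨_, J, hJ, rfl⟩
      (by rintro _ ⟨K, hK, rfl⟩; exact mem_JRho_iff.2 (.inr ⟨K, hSc K hK, rfl⟩))
      (by ext x; simp [hIS, fullBox])
    rwa [le_antisymm (le_of_fullBox_subset hKI.ge) (le_of_fullBox_subset hKI.le)]
  · intro h X hX S hS hne hSc hXS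
    rcases mem_JRho_iff.1 hX with rfl | ⟨I, hI, rfl⟩
    · obtain ⟨Y, hY⟩ := hne
      rwa [← Set.sUnion_eq_empty.1 hXS.symm Y hY]
    · refine h I hI (fullBox ⁻¹' S ∩ {J | IsConstructibleIdeal J})
        (Set.Finite.inter_of_left (hS.preimage fun J _ K _ hJK =>
          le_antisymm (le_of_fullBox_subset hJK.le) (le_of_fullBox_subset hJK.ge)) _)
        (fun J hJ => hJ.2) ?_ |>.1
      intro x
      constructor
      · intro hx
        have aux : ∀ y ∈ I, y ≠ 0 → ∃ J ∈ fullBox ⁻¹' S ∩ {J | IsConstructibleIdeal J}, y ∈ J := by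
          intro y hy hy0
          have hmem : ((0, ⟨y, hy0⟩) : AxB R) ∈ fullBox I := hy
          rw [hXS] at hmem
          obtain ⟨Y, hY, hyY⟩ := hmem
          rcases mem_JRho_iff.1 (hSc hY) with rfl | ⟨J, hJ, rfl⟩
          · exact hyY.elim
          · exact ⟨J, ⟨hY, hJ⟩, hyY⟩
        by_cases hx0 : x = 0
        · obtain ⟨y, hy, hy0⟩ := hI.exists_ne_zero
          obtain ⟨J, hJ, -⟩ := aux y hy hy0
          exact ⟨J, hJ, hx0 ▸ J.zero_mem⟩
        · exact aux x hx hx0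
      · rintro ⟨J, ⟨hJS, -⟩, hx⟩
        exact le_of_fullBox_subset (hXS ▸ Set.subset_sUnion_of_mem hJS) hx

theorem isIndependentFamily_JLambda_of_cI (h : IsIndependentFamily (cI R)) :
    IsIndependentFamily (JLambda R) := by
  rw [isIndependentFamily_cI_iff] at h
  rw [isIndependentFamily_iff]
  intro X hX S hS hne hSc hXS
  rcases mem_JLambda_iff.1 hX with rfl | ⟨I, b, hI, rfl⟩
  · obtain ⟨Y, hY⟩ := hne
    rwa [← Set.sUnion_eq_empty.1 hXS.symm Y hY]
  · have hfin : {J : Ideal R | IsConstructibleIdeal J ∧ ∃ d, cosetBox J d ∈ S}.Finite := by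
      refine Set.Finite.of_injOn (f := fun J : Ideal R => {w : {a : R // a ≠ 0} | w.1 ∈ J})
        (t := Set.image Prod.snd '' S) ?_ ?_ (hS.image _)
      · rintro J ⟨-, d, hd⟩
        refine ⟨_, hd, ?_⟩
        ext w
        exact ⟨by rintro ⟨p, hp, rfl⟩; exact hp.2, fun hw => ⟨(d, w), ⟨by simp, hw⟩, rfl⟩⟩
      · intro J _ K _ hJK
        exact le_antisymm (le_of_fullBox_subset fun p hp => (Set.ext_iff.1 hJK p.2).1 hp)
          (le_of_fullBox_subset fun p hp => (Set.ext_iff.1 hJK p.2).2 hp)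
    have hmem : I ∈ {J : Ideal R | IsConstructibleIdeal J ∧ ∃ d, cosetBox J d ∈ S} := by
      refine h I hI _ hfin (fun J hJ => hJ.1) fun x => ⟨fun hx => ?_, ?_⟩
      · have aux : ∀ y ∈ I, y ≠ 0 →
            ∃ J ∈ {J : Ideal R | IsConstructibleIdeal J ∧ ∃ d, cosetBox J d ∈ S}, y ∈ J := by
          intro y hy hy0
          have hmem : ((b, ⟨y, hy0⟩) : AxB R) ∈ cosetBox I b := ⟨by simp, hy⟩
          rw [hXS] at hmem
          obtain ⟨Y, hY, hyY⟩ := hmem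
          rcases mem_JLambda_iff.1 (hSc hY) with rfl | ⟨J, d, hJ, rfl⟩
          · exact hyY.elim
          · exact ⟨J, ⟨hJ, d, hY⟩, hyY.2⟩
        by_cases hx0 : x = 0
        · obtain ⟨y, hy, hy0⟩ := hI.exists_ne_zero
          obtain ⟨J, hJ, -⟩ := aux y hy hy0
          exact ⟨J, hJ, hx0 ▸ J.zero_mem⟩
        · exact aux x hx hx0
      · rintro ⟨J, ⟨-, d, hd⟩, hx⟩
        exact le_of_cosetBox_subset (hXS ▸ Set.subset_sUnion_of_mem hd) hx
    obtain ⟨-, d, hd⟩ := hmem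
    obtain ⟨p, hp⟩ := hI.cosetBox_nonempty d
    have hp' : p ∈ cosetBox I b := hXS ▸ Set.mem_sUnion_of_mem hp hd
    rwa [cosetBox_eq_of_sub_mem (d := d)]
    have : b - d = (p.1 - d) - (p.1 - b) := by ring
    exact this ▸ I.sub_mem hp.1 hp'.1

theorem isIndependentFamily_cI_of_JLambda (h : IsIndependentFamily (JLambda R)) :
    IsIndependentFamily (cI R) := by
  rw [isIndependentFamily_iff] at h
  rw [isIndependentFamily_cI_iff]
  intro I hI S hS hSc hIS
  set H : Ideal R → AddSubgroup I.toAddSubgroup :=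
    fun J => J.toAddSubgroup.addSubgroupOf I.toAddSubgroup with hH
  set T : Set (Set (AxB R)) := ⋃ J ∈ {J ∈ S | (H J).FiniteIndex},
    Set.range fun c : I.toAddSubgroup ⧸ H J => cosetBox J (c.out : R) with hT
  have hTfin : T.Finite := by
    refine (hS.subset (Set.sep_subset _ _)).biUnion fun J hJ => ?_
    have := hJ.2
    have : Finite (I.toAddSubgroup ⧸ H J) := AddSubgroup.finite_quotient_of_finiteIndex
    exact Set.finite_range _
  have hU : cosetBox I 0 = ⋃₀ T := by
    ext ⟨x, w⟩
    simp only [hT, Set.mem_sUnion, Set.mem_iUnion, Set.mem_range]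
    constructor
    · rintro ⟨hx, hw⟩
      obtain ⟨J, hJ, hwJ, hfin⟩ := exists_mem_finite_quotient hS (fun x => (hIS x).1) hw
      have hx : x ∈ I := by simpa using hx
      refine ⟨_, ⟨J, ⟨hJ, hfin⟩, QuotientAddGroup.mk (⟨x, hx⟩ : I.toAddSubgroup), rfl⟩, ?_, hwJ⟩
      have := QuotientAddGroup.eq.1
        (QuotientAddGroup.out_eq' (QuotientAddGroup.mk (s := H J) (⟨x, hx⟩ : I.toAddSubgroup)))
      have : -_ + x ∈ J := this
      rwa [neg_add_eq_sub] at this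
    · rintro ⟨_, ⟨J, ⟨hJ, -⟩, c, rfl⟩, hx, hw⟩
      have hle : ∀ y ∈ J, y ∈ I := fun y hy => (hIS y).2 ⟨J, hJ, hy⟩
      refine ⟨?_, hle _ hw⟩
      have := I.add_mem (hle _ hx) c.out.2
      simpa using this
  have hTc : T ⊆ JLambda R := by
    intro Y hY
    simp only [hT, Set.mem_iUnion, Set.mem_range] at hY
    obtain ⟨J, ⟨hJ, -⟩, c, rfl⟩ := hY
    exact mem_JLambda_iff.2 (.inr ⟨J, _, hSc J hJ, rfl⟩)
  have hTne : T.Nonempty := by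
    have := hI.cosetBox_nonempty 0
    rw [hU] at this
    exact this.of_sUnion
  have hmem := h _ (mem_JLambda_iff.2 (.inr ⟨I, 0, hI, rfl⟩)) T hTfin hTne hTc hU
  simp only [hT, Set.mem_iUnion, Set.mem_range] at hmem
  obtain ⟨J, ⟨hJ, -⟩, c, hc⟩ := hmem
  rwa [le_antisymm (le_of_cosetBox_subset hc.ge) (le_of_cosetBox_subset hc.le)]

end Constructible

/-- The following are equivalent: independence of `J_λ(R ⋊ R×)`,
independence of `J_ρ(R ⋊ R×)`, and independence of `I(R)`. -/
theorem independence_tfae (R : Type*) [CommRing R] [IsDomain R] :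
    (IsIndependentFamily (JLambda R) ↔ IsIndependentFamily (JRho R)) ∧
    (IsIndependentFamily (JRho R) ↔ IsIndependentFamily (cI R)) :=
  ⟨⟨fun h => isIndependentFamily_JRho_iff.2 (isIndependentFamily_cI_of_JLambda h),
      fun h => isIndependentFamily_JLambda_of_cI (isIndependentFamily_JRho_iff.1 h)⟩,
    isIndependentFamily_JRho_iff⟩
end

section
/- Let R be an integral domain such that for all I, J ∈ I(R) with I ⊊ J, the quotient group J/I is infinite. Then I(R) is independent. -/
/-- Every constructible set is (the underlying set of) an ideal. -/
theorem exists_ideal_of_mem_cI {R : Type*} [CommRing R] {X : Set R} (hX : X ∈ cI R) :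
    ∃ I : Ideal R, (I : Set R) = X := by
  obtain ⟨n, a, c, -, -, rfl⟩ := hX
  refine ⟨Submodule.comap (LinearMap.mulLeft R c) (⨅ i, Ideal.span {a i}), ?_⟩
  ext r
  simp [Ideal.mem_span_singleton, Dvd.dvd]

/-- An additive subgroup `I` whose trace on `J` has finite index has finitely many cosets
with representatives in `J`. -/
theorem finite_setOf_cosets {G : Type*} [AddCommGroup G] (I J : AddSubgroup G)
    [(I.addSubgroupOf J).FiniteIndex] :
    { s : Set G | ∃ j ∈ J, s = (fun x => j + x) '' (I : Set G) }.Finite := by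
  have : Finite (J ⧸ I.addSubgroupOf J) := AddSubgroup.finite_quotient_of_finiteIndex
  refine (Set.finite_range fun q : J ⧸ I.addSubgroupOf J =>
    (fun x => (q.out : G) + x) '' (I : Set G)).subset ?_
  rintro s ⟨j, hj, rfl⟩
  refine ⟨((⟨j, hj⟩ : J) : J ⧸ I.addSubgroupOf J), ?_⟩
  have hmem : -((QuotientAddGroup.mk (s := I.addSubgroupOf J) ⟨j, hj⟩).out : G) + j ∈ I := by
    simpa [AddSubgroup.mem_addSubgroupOf] using
      QuotientAddGroup.eq.mp
        (QuotientAddGroup.out_eq' (QuotientAddGroup.mk (s := I.addSubgroupOf J) ⟨j, hj⟩))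
  exact (leftAddCoset_eq_iff I).mpr hmem

/-- If for all `I, J ∈ I(R)` with `I ⊊ J` the quotient `J / I` is infinite
(i.e. there are infinitely many cosets `j + I` with `j ∈ J`),
then `I(R)` is independent. -/
theorem independent_of_infinite_quotients (R : Type*) [CommRing R] [IsDomain R]
    (h : ∀ I J : Set R, I ∈ cI R → J ∈ cI R → I ⊂ J →
      { s : Set R | ∃ j ∈ J, s = (fun x => j + x) '' I }.Infinite) :
    IsIndependentFamily (cI R) := by
  intro X n Xs hX hXs hcover
  obtain ⟨J, hJ⟩ := exists_ideal_of_mem_cI hX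
  choose I hI using fun i => exists_ideal_of_mem_cI (hXs i)
  have hcover' : ⋃ i ∈ (Finset.univ : Finset (Fin (n + 1))),
      ((Submodule.comap J.subtype (I i) : Submodule R J) : Set J) = Set.univ := by
    refine Set.eq_univ_of_forall fun x => ?_
    have hx : (x : R) ∈ ⋃ i, Xs i := hcover ▸ hJ ▸ x.2
    simpa [← hI] using hx
  obtain ⟨k, -, hk⟩ := Submodule.exists_finiteIndex_of_cover hcover'
  refine ⟨k, ?_⟩
  by_contra hne
  have hss : Xs k ⊂ X :=
    (hcover ▸ Set.subset_iUnion Xs k : Xs k ⊆ X).ssubset_of_ne (Ne.symm hne)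
  have : ((I k).toAddSubgroup.addSubgroupOf J.toAddSubgroup).FiniteIndex := hk
  have hfin := finite_setOf_cosets (I k).toAddSubgroup J.toAddSubgroup
  refine h _ _ (hXs k) hX hss ?_
  rw [← hI, ← hJ]
  exact hfin
end

section
/- Let R be an integral domain such that every ideal in I(R) is an invertible fractional ideal (i.e., for every I ∈ I(R) there is an R-submodule I' of Q with I·I' = R). Then I(R) is independent. -/
/-- If `m • N ≠ N` for each `m` in a finite set of maximal ideals, then the submodules `m • N` do not
cover `N`. -/
theorem exists_mem_forall_notMem_smul {R M : Type*} [CommRing R] [AddCommGroup M] [Module R M]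
    (N : Submodule R M) (S : Finset (Ideal R)) (hmax : ∀ m ∈ S, m.IsMaximal)
    (hN : ∀ m ∈ S, m • N ≠ N) : ∃ x ∈ N, ∀ m ∈ S, x ∉ m • N := by
  classical
  have hx : ∀ m ∈ S, ∃ x ∈ N, x ∉ m • N := fun m hm =>
    SetLike.exists_of_lt (lt_of_le_of_ne Submodule.smul_le_right (hN m hm))
  have he : ∀ m ∈ S, ∃ e : R, e ∉ m ∧ ∀ m' ∈ S, m' ≠ m → e ∈ m' := by
    intro m hm
    have hprime := (hmax m hm).isPrime
    have hle : ¬ (S.erase m).inf id ≤ m := by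
      rw [hprime.inf_le']
      rintro ⟨m', hm', hle⟩
      rw [Finset.mem_erase] at hm'
      exact hm'.1 ((hmax m' hm'.2).eq_of_le hprime.ne_top hle)
    obtain ⟨e, he, hem⟩ := SetLike.not_le_iff_exists.mp hle
    refine ⟨e, hem, fun m' hm' hne => ?_⟩
    exact (Finset.inf_le (f := id) (Finset.mem_erase.mpr ⟨hne, hm'⟩) : _ ≤ m') he
  choose! x hxN hxm using hx
  choose! e hem he using he
  refine ⟨∑ m ∈ S, e m • x m, sum_mem fun m hm => N.smul_mem _ (hxN m hm), fun m hm hmem => ?_⟩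
  rw [← Finset.add_sum_erase S _ hm] at hmem
  have hrest : ∑ m' ∈ S.erase m, e m' • x m' ∈ m • N := by
    refine sum_mem fun m' hm' => ?_
    rw [Finset.mem_erase] at hm'
    exact Submodule.smul_mem_smul (he m' hm'.2 m hm hm'.1.symm) (hxN m' hm'.2)
  have hex : e m • x m ∈ m • N := (Submodule.add_mem_iff_left _ hrest).mp hmem
  obtain ⟨u, v, hv, huv⟩ := (hmax m hm).exists_inv (hem m hm)
  apply hxm m hm
  rw [← one_smul R (x m), ← huv, add_smul, mul_smul]
  exact add_mem (Submodule.smul_mem _ u hex) (Submodule.smul_mem_smul hv (hxN m hm))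

/-- A submodule strictly contained in an invertible submodule `V` of an algebra is contained in
`m • V` for some maximal ideal `m`. -/
theorem exists_isMaximal_le_smul {R A : Type*} [CommRing R] [CommRing A] [Algebra R A]
    {V V' W : Submodule R A} (hV : V * V' = 1) (hW : W < V) :
    ∃ m : Ideal R, m.IsMaximal ∧ W ≤ m • V := by
  have hle : W * V' ≤ 1 := hV ▸ mul_le_mul_left hW.le V'
  have hmap : ((W * V').comap (Algebra.linearMap R A)).map (Algebra.linearMap R A) = W * V' :=
    Submodule.map_comap_eq_of_le (by rwa [← Submodule.one_eq_range])
  have hWV : W * V' * V = W := by rw [mul_assoc, mul_comm V', hV, mul_one]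
  obtain ⟨m, hm, hle'⟩ := Ideal.exists_le_maximal ((W * V').comap (Algebra.linearMap R A)) <| by
    intro htop
    rw [htop, Submodule.map_top, ← Submodule.one_eq_range] at hmap
    rw [← hmap, one_mul] at hWV
    exact hW.ne hWV.symm
  refine ⟨m, hm, ?_⟩
  rw [← hWV, ← hmap, Submodule.mul_le]
  rintro _ ⟨r, hr, rfl⟩ v hv
  rw [Algebra.linearMap_apply, ← Algebra.smul_def]
  exact Submodule.smul_mem_smul (hle' hr) hv

/-- An invertible submodule `V` of a faithful algebra satisfies `m • V ≠ V` for every proper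
ideal `m`. -/
theorem smul_ne_self_of_mul_eq_one {R A : Type*} [CommRing R] [CommRing A] [Algebra R A]
    (hinj : Function.Injective (algebraMap R A)) {V V' : Submodule R A} (hV : V * V' = 1)
    {m : Ideal R} (hm : m ≠ ⊤) : m • V ≠ V := by
  intro h
  have hone : m • (1 : Submodule R A) = 1 := by rw [← hV, ← smul_mul_assoc, h]
  have hle : m • (1 : Submodule R A) ≤ Submodule.map (Algebra.linearMap R A) m := by
    rw [Submodule.smul_le]
    rintro r hr _ hn
    obtain ⟨s, rfl⟩ := Submodule.mem_one.mp hn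
    exact ⟨r * s, m.mul_mem_right s hr, by simp [Algebra.smul_def]⟩
  have h1 : (1 : A) ∈ m • (1 : Submodule R A) := Submodule.one_le.mp hone.ge
  obtain ⟨r, hr, hr1⟩ := hle h1
  have : r = 1 := hinj (by simpa using hr1)
  exact hm ((Ideal.eq_top_iff_one m).mpr (this ▸ hr))

/-- If every ideal in `I(R)` is an invertible fractional ideal (i.e. for every
`I ∈ I(R)` there is an `R`-submodule `I'` of the quotient field `Q` with
`I·I' = R`), then `I(R)` is independent. -/
theorem independent_of_invertible (R Q : Type*) [CommRing R] [IsDomain R]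
    [Field Q] [Algebra R Q] [IsFractionRing R Q]
    (h : ∀ I ∈ cI R, ∃ I' : Submodule R Q,
      Submodule.span R (algebraMap R Q '' I) * I' = 1) :
    IsIndependentFamily (cI R) := by
  intro X n Xs hX hXs hU
  have hinj : Function.Injective (algebraMap R Q) := IsFractionRing.injective R Q
  obtain ⟨V', hV⟩ := h X hX
  obtain ⟨I, rfl⟩ := exists_ideal_of_mem_cI hX
  choose J hJ using fun i => exists_ideal_of_mem_cI (hXs i)
  have hspan : Submodule.span R (algebraMap R Q '' I) = Submodule.map (Algebra.linearMap R Q) I := by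
    rw [← Algebra.coe_linearMap, Submodule.span_image, Submodule.span_eq]
  rw [hspan] at hV
  have hinj' : Function.Injective (Submodule.map (Algebra.linearMap R Q)) :=
    Submodule.map_injective_of_injective hinj
  by_contra! hne
  have hlt : ∀ i, Submodule.map (Algebra.linearMap R Q) (J i) <
      Submodule.map (Algebra.linearMap R Q) I := by
    intro i
    refine lt_of_le_of_ne (Submodule.map_mono ?_) fun heq => hne i ?_
    · rw [← SetLike.coe_subset_coe, hJ, hU]
      exact Set.subset_iUnion Xs i
    · rw [← hJ, hinj' heq]
  choose m hmax hle using fun i => exists_isMaximal_le_smul hV (hlt i)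
  obtain ⟨x, hx, hxm⟩ := exists_mem_forall_notMem_smul (Submodule.map (Algebra.linearMap R Q) I)
    (Finset.univ.image m) (by simpa using hmax)
    (by simpa using fun i => smul_ne_self_of_mul_eq_one hinj hV (hmax i).ne_top)
  obtain ⟨r, hr, rfl⟩ := hx
  rw [hU] at hr
  obtain ⟨i, hi⟩ := Set.mem_iUnion.mp hr
  rw [← hJ] at hi
  exact hxm (m i) (by simp) (hle i ⟨r, hi, rfl⟩)
end

section
/- Every Krull ring satisfies the independence condition: if R is an integral domain with field of fractions Q admitting a family (v_p)_{p∈P} of discrete valuations of Q satisfying (K1), (K2) and the approximation property, then I(R) is independent. -/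
/-- `R` is a Krull ring, presented via a family `(v_p)_{p ∈ ι}` of discrete
valuations of its quotient field `Q`: each `v_p` is a surjective homomorphism
`Q× → ℤ` satisfying the ultrametric inequality, such that
(K1) `R∖{0} = { x ∈ Q× : v_p(x) ≥ 0 for all p }`,
(K2) for every `x ∈ Q×`, `v_p(x) ≠ 0` for only finitely many `p`, and
(approximation) prescribed values can be attained on any finite set of indices
while remaining nonnegative elsewhere. -/
def IsKrullFamily (R : Type*) {Q : Type*} {ι : Type*} [CommRing R] [Field Q] [Algebra R Q]
    (v : ι → Q → ℤ) : Prop :=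
  (∀ p, ∀ n : ℤ, ∃ x : Q, x ≠ 0 ∧ v p x = n) ∧
  (∀ p, ∀ x y : Q, x ≠ 0 → y ≠ 0 → v p (x * y) = v p x + v p y) ∧
  (∀ p, ∀ x y : Q, x ≠ 0 → y ≠ 0 → x + y ≠ 0 → min (v p x) (v p y) ≤ v p (x + y)) ∧
  (∀ x : Q, x ≠ 0 → ((∃ r : R, algebraMap R Q r = x) ↔ ∀ p, 0 ≤ v p x)) ∧
  (∀ x : Q, x ≠ 0 → { p | v p x ≠ 0 }.Finite) ∧
  (∀ (s : Finset ι) (n : ι → ℤ),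
    ∃ x : Q, x ≠ 0 ∧ (∀ p ∈ s, v p x = n p) ∧ ∀ p ∉ s, 0 ≤ v p x)

/-- A constructible ideal of a Krull ring is cut out by finitely many lower bounds on the valuations. -/
theorem IsKrullFamily.exists_exponent {R Q ι : Type*} [CommRing R] [IsDomain R]
    [Field Q] [Algebra R Q] [IsFractionRing R Q]
    {v : ι → Q → ℤ} (hv : IsKrullFamily R v) {I : Set R} (hI : I ∈ cI R) :
    ∃ e : ι → ℤ, (∀ p, 0 ≤ e p) ∧ {p | e p ≠ 0}.Finite ∧ 0 ∈ I ∧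
      ∀ r : R, r ≠ 0 → (r ∈ I ↔ ∀ p, e p ≤ v p (algebraMap R Q r)) := by
  obtain ⟨-, hmul, -, hK1, hK2, -⟩ := hv
  obtain ⟨n, a, c, ha, hc, rfl⟩ := hI
  have hinj := IsFractionRing.injective R Q
  have hne : ∀ r : R, r ≠ 0 → algebraMap R Q r ≠ 0 := fun r hr =>
    (map_ne_zero_iff _ hinj).2 hr
  refine ⟨fun p => max 0 (Finset.univ.sup' Finset.univ_nonempty
    fun i => v p (algebraMap R Q (a i)) - v p (algebraMap R Q c)),
    fun p => le_max_left _ _, ?_, fun i => ⟨0, by simp⟩, fun r hr => ?_⟩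
  · refine ((hK2 _ (hne c hc)).union
      (Set.finite_iUnion fun i => hK2 _ (hne (a i) (ha i)))).subset fun p hp => ?_
    by_contra h
    simp only [Set.mem_union, Set.mem_iUnion, Set.mem_ofPred_eq, not_or, not_exists,
      not_not] at h
    exact hp (by simp [h.1, h.2])
  · have hrv : ∀ p, 0 ≤ v p (algebraMap R Q r) := (hK1 _ (hne r hr)).1 ⟨r, rfl⟩
    have key : ∀ i, (∃ t : R, c * r = a i * t) ↔
        ∀ p, v p (algebraMap R Q (a i)) - v p (algebraMap R Q c) ≤ v p (algebraMap R Q r) := by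
      intro i
      have hx : algebraMap R Q c * algebraMap R Q r / algebraMap R Q (a i) ≠ 0 :=
        div_ne_zero (mul_ne_zero (hne c hc) (hne r hr)) (hne _ (ha i))
      have hdiv : (∃ t : R, c * r = a i * t) ↔ ∃ t : R, algebraMap R Q t =
          algebraMap R Q c * algebraMap R Q r / algebraMap R Q (a i) := by
        refine exists_congr fun t => ?_
        rw [eq_div_iff (hne _ (ha i)), ← map_mul, ← map_mul, hinj.eq_iff, mul_comm t, eq_comm]
      rw [hdiv, hK1 _ hx]
      refine forall_congr' fun p => ?_
      have h := hmul p _ _ hx (hne _ (ha i))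
      rw [div_mul_cancel₀ _ (hne _ (ha i)), hmul p _ _ (hne c hc) (hne r hr)] at h
      omega
    simp only [Set.mem_ofPred_eq, key, max_le_iff, hrv, true_and, Finset.sup'_le_iff,
      Finset.mem_univ, true_imp_iff]
    exact forall_comm

/-- Every Krull ring satisfies the independence condition. -/
theorem krull_ring_independent (R Q ι : Type*) [CommRing R] [IsDomain R]
    [Field Q] [Algebra R Q] [IsFractionRing R Q]
    (v : ι → Q → ℤ) (hv : IsKrullFamily R v) :
    IsIndependentFamily (cI R) := by
  classical
  intro X n Xs hX hXs hU
  obtain ⟨e, he0, hefin, -, he⟩ := hv.exists_exponent hX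
  choose f _ _ hf0 hf using fun i => hv.exists_exponent (hXs i)
  by_contra! hcon
  have hlt : ∀ i, ∃ p, e p < f i p := by
    intro i
    by_contra! hle
    refine hcon i (Set.Subset.antisymm (fun r hr => ?_) (hU ▸ Set.subset_iUnion Xs i))
    rcases eq_or_ne r 0 with rfl | h0
    · exact hf0 i
    · exact (hf i r h0).2 fun p => (hle p).trans ((he r h0).1 hr p)
  choose p hp using hlt
  obtain ⟨-, -, -, hK1, -, happ⟩ := hv
  obtain ⟨x, hx0, hxs, hxn⟩ := happ (hefin.toFinset ∪ Finset.univ.image p) e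
  have hex : ∀ q, e q ≤ v q x := by
    intro q
    by_cases hq : q ∈ hefin.toFinset ∪ Finset.univ.image p
    · exact (hxs q hq).ge
    · have hq0 : e q = 0 := by
        by_contra h
        exact hq (Finset.mem_union_left _ (hefin.mem_toFinset.2 h))
      exact hq0 ▸ hxn q hq
  obtain ⟨r, rfl⟩ := (hK1 x hx0).2 fun q => (he0 q).trans (hex q)
  have hr0 : r ≠ 0 := by
    rintro rfl
    exact hx0 (map_zero _)
  have hrX : r ∈ X := (he r hr0).2 hex
  rw [hU, Set.mem_iUnion] at hrX
  obtain ⟨i, hi⟩ := hrX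
  have h1 := (hf i r hr0).1 hi (p i)
  have h2 := hxs (p i)
    (Finset.mem_union_right _ (Finset.mem_image_of_mem p (Finset.mem_univ i)))
  exact absurd (hp i) (by omega)
end

section
/- Let R be an integral domain with field of fractions Q. For x, y ∈ Q and I, J ∈ I(R⊆Q), there exists (b,a) ∈ Q⋊Q× with (b,a)·((x+I) × (I∖{0})) = (y+J) × (J∖{0}) if and only if there exists a ∈ Q× with aI = J. -/
/-- The family `I(R ⊆ Q) = { x₁R ∩ … ∩ xₙR : n ≥ 1, xᵢ ∈ Q× }` of finite
intersections of nonzero principal fractional ideals of `R` inside `Q`. -/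
def IRQ (R Q : Type*) [CommRing R] [Field Q] [Algebra R Q] : Set (Set Q) :=
  { J | ∃ (n : ℕ) (x : Fin (n + 1) → Q), (∀ i, x i ≠ 0) ∧
      J = ⋂ i, (fun r : Q => x i * r) '' Set.range (algebraMap R Q) }

theorem zero_mem_of_mem_IRQ {R Q : Type*} [CommRing R] [Field Q] [Algebra R Q] {I : Set Q}
    (hI : I ∈ IRQ R Q) : (0 : Q) ∈ I := by
  obtain ⟨n, x, -, rfl⟩ := hI
  exact Set.mem_iInter.2 fun i => ⟨0, ⟨0, map_zero _⟩, mul_zero _⟩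

/-- For `x, y ∈ Q` and `I, J ∈ I(R ⊆ Q)`, there exists `(b,a) ∈ Q ⋊ Q×` with
`(b,a)·((x+I) × (I∖{0})) = (y+J) × (J∖{0})` if and only if there exists
`a ∈ Q×` with `aI = J`. -/
theorem axb_orbit_iff (R Q : Type*) [CommRing R] [IsDomain R]
    [Field Q] [Algebra R Q] [IsFractionRing R Q]
    (x y : Q) (I J : Set Q) (hI : I ∈ IRQ R Q) (hJ : J ∈ IRQ R Q) :
    (∃ b a : Q, a ≠ 0 ∧
      (fun p : Q × Q => (b + a * p.1, a * p.2)) ''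
          { p : Q × Q | p.1 ∈ (fun t => x + t) '' I ∧ p.2 ∈ I ∧ p.2 ≠ 0 }
        = { p : Q × Q | p.1 ∈ (fun t => y + t) '' J ∧ p.2 ∈ J ∧ p.2 ≠ 0 })
    ↔ (∃ a : Q, a ≠ 0 ∧ (fun t => a * t) '' I = J) := by
  have hI0 := zero_mem_of_mem_IRQ hI
  have hJ0 := zero_mem_of_mem_IRQ hJ
  constructor
  · rintro ⟨b, a, ha, h⟩
    refine ⟨a, ha, Set.Subset.antisymm ?_ fun s hs => ?_⟩
    · rintro _ ⟨t, ht, rfl⟩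
      by_cases ht0 : t = 0
      · simpa [ht0] using hJ0
      · exact (h.subset ⟨(x, t), ⟨⟨0, hI0, add_zero x⟩, ht, ht0⟩, rfl⟩).2.1
    · by_cases hs0 : s = 0
      · exact ⟨0, hI0, by simp [hs0]⟩
      · obtain ⟨p, ⟨-, hp, -⟩, hps⟩ :=
          h.superset (show (y, s) ∈ _ from ⟨⟨0, hJ0, add_zero y⟩, hs, hs0⟩)
        exact ⟨p.2, hp, congrArg Prod.snd hps⟩
  · rintro ⟨a, ha, rfl⟩
    refine ⟨y - a * x, a, ha, Set.Subset.antisymm ?_ ?_⟩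
    · rintro _ ⟨⟨_, t⟩, ⟨⟨u, hu, rfl⟩, ht, ht0⟩, rfl⟩
      exact ⟨⟨a * u, ⟨u, hu, rfl⟩, by ring⟩, ⟨t, ht, rfl⟩, mul_ne_zero ha ht0⟩
    · rintro ⟨_, _⟩ ⟨⟨_, ⟨u, hu, rfl⟩, rfl⟩, ⟨t, ht, rfl⟩, hat⟩
      exact ⟨(x + u, t), ⟨⟨u, hu, rfl⟩, ht, right_ne_zero_of_mul hat⟩,
        Prod.ext (by ring) rfl⟩
end

section
/- Let R be a Krull ring with field of fractions Q, essential valuations (v_p)_{p∈P}, and P ≠ ∅. Let (b,a) ∈ Q × Q× with (b,a) ≠ (0,1), let S ⊆ P_fin, let p₀ ∈ P, let F ⊆ S be finite, let N ∈ ℕ, let r ∈ Q, and let m : P → ℤ be finitely supported with I := I(m). Then there exist s ∈ Q and a finitely supported n : P → ℤ such that, with J := I(n): (i) (s+J) ∩ ((b+as) + aJ) = ∅; (ii) s+J ⊆ r+I; (iii) n_q ≥ N for all q ∈ F; (iv) n_p = m_p for all p ∈ P_fin∖S with p ≠ p₀. -/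
/-- For a (finitely supported) `m : ι → ℤ`, the divisorial ideal
`I(m) = {0} ∪ { x ∈ Q× : v_p(x) ≥ m_p for all p }`. -/
def Imap {Q ι : Type*} (v : ι → Q → ℤ) [Zero Q] (m : ι → ℤ) : Set Q :=
  { x | x ≠ 0 → ∀ p, m p ≤ v p x }

/-- The divisorial prime power `p^{(i)} = {0} ∪ { x ∈ R∖{0} : v_p(x) ≥ i }`,
as a subset of `R`. -/
def pPowSet (R : Type*) {Q ι : Type*} [CommRing R] [Field Q] [Algebra R Q]
    (v : ι → Q → ℤ) (p : ι) (i : ℕ) : Set R :=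
  { r | r ≠ 0 → (i : ℤ) ≤ v p (algebraMap R Q r) }

/-- `P_fin` is the set of indices `p` such that `R / p^{(i)}` is finite
(i.e. `p^{(i)}` has finitely many cosets in `R`) for every `i ∈ ℕ`. -/
def Pfin (R : Type*) {Q ι : Type*} [CommRing R] [Field Q] [Algebra R Q]
    (v : ι → Q → ℤ) : Set ι :=
  { p | ∀ i : ℕ, { s : Set R | ∃ r : R, s = (fun x => r + x) '' pPowSet R v p i }.Finite }

/-- A divisorial ideal `I(m)` contains a nonzero element. -/
theorem IsKrullFamily.exists_ne_zero_mem_Imap {R Q ι : Type*} [CommRing R] [Field Q] [Algebra R Q]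
    {v : ι → Q → ℤ} (hv : IsKrullFamily R v) {m : ι → ℤ} (hm : { p | m p ≠ 0 }.Finite) :
    ∃ x : Q, x ≠ 0 ∧ x ∈ Imap v m := by
  obtain ⟨-, -, -, -, -, happrox⟩ := hv
  obtain ⟨x, hx, hx_eq, hx_nonneg⟩ := happrox hm.toFinset m
  refine ⟨x, hx, fun _ p => ?_⟩
  by_cases hp : p ∈ hm.toFinset
  · exact (hx_eq p hp).ge
  · have hmp : m p = 0 := by simpa using hp
    exact hmp.le.trans (hx_nonneg p hp)

theorem Imap_antitone {Q ι : Type*} [Zero Q] (v : ι → Q → ℤ) : Antitone (Imap v) :=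
  fun _ _ h _ hx hx0 p => (h p).trans (hx hx0 p)

/-- Divisorial ideals are closed under addition. -/
theorem IsKrullFamily.add_mem_Imap {R Q ι : Type*} [CommRing R] [Field Q] [Algebra R Q]
    {v : ι → Q → ℤ} (hv : IsKrullFamily R v) {m : ι → ℤ} {x y : Q}
    (hx : x ∈ Imap v m) (hy : y ∈ Imap v m) : x + y ∈ Imap v m := by
  intro hxy p
  by_cases hx0 : x = 0
  · subst hx0
    rw [zero_add] at hxy ⊢
    exact hy hxy p
  by_cases hy0 : y = 0
  · subst hy0
    rw [add_zero] at hxy ⊢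
    exact hx hxy p
  exact (le_min (hx hx0 p) (hy hy0 p)).trans (hv.2.2.1 p x y hx0 hy0 hxy)

/-- If `n p` is large compared with `v p c`, then `c ≠ 0` is not of the form `x + d * y` with
`x, y ∈ I(n)`. -/
theorem IsKrullFamily.add_mul_ne {R Q ι : Type*} [CommRing R] [Field Q] [Algebra R Q]
    {v : ι → Q → ℤ} (hv : IsKrullFamily R v) {n : ι → ℤ} {c d : Q} (hc : c ≠ 0) (hd : d ≠ 0)
    (p : ι) (hn : v p c < n p) (hnd : v p c < v p d + n p) {x y : Q}
    (hx : x ∈ Imap v n) (hy : y ∈ Imap v n) : x + d * y ≠ c := by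
  rintro rfl
  obtain ⟨-, hmul, hadd, -⟩ := hv
  by_cases hy0 : y = 0
  · subst hy0
    rw [mul_zero, add_zero] at hc hn
    exact (hx hc p).not_gt hn
  have hvdy := hmul p d y hd hy0
  have hny := hy hy0 p
  by_cases hx0 : x = 0
  · subst hx0
    rw [zero_add] at hnd
    omega
  have hmin := hadd p x (d * y) hx0 (mul_ne_zero hd hy0) hc
  have hnx := hx hx0 p
  omega

/-- Key lemma towards triviality of stabilizers: given `(b,a) ≠ (0,1)`,
`S ⊆ P_fin`, `p₀ ∈ P`, a finite `F ⊆ S`, `N ∈ ℕ`, `r ∈ Q` and a finitely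
supported `m : P → ℤ` with `I = I(m)`, there are `s ∈ Q` and a finitely
supported `n : P → ℤ`, with `J = I(n)`, such that
(i) `(s+J) ∩ ((b+as) + aJ) = ∅`; (ii) `s+J ⊆ r+I`; (iii) `n_q ≥ N` for all
`q ∈ F`; (iv) `n_p = m_p` for all `p ∈ P_fin∖S` with `p ≠ p₀`. -/
theorem key_disjointness_lemma (R Q ι : Type*) [CommRing R] [IsDomain R]
    [Field Q] [Algebra R Q] [IsFractionRing R Q]
    (v : ι → Q → ℤ) (hv : IsKrullFamily R v) (hP : Nonempty ι)
    (b a : Q) (ha : a ≠ 0) (hba : (b, a) ≠ ((0 : Q), (1 : Q)))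
    (S : Set ι) (hS : S ⊆ Pfin R v)
    (p₀ : ι) (F : Finset ι) (hF : ↑F ⊆ S) (N : ℕ) (r : Q)
    (m : ι → ℤ) (hm : { p | m p ≠ 0 }.Finite) :
    ∃ (s : Q) (n : ι → ℤ), { p | n p ≠ 0 }.Finite ∧
      ((fun x => s + x) '' Imap v n) ∩
        ((fun x => (b + a * s) + a * x) '' Imap v n) = ∅ ∧
      (fun x => s + x) '' Imap v n ⊆ (fun x => r + x) '' Imap v m ∧
      (∀ q ∈ F, (N : ℤ) ≤ n q) ∧
      (∀ p, p ∈ Pfin R v → p ∉ S → p ≠ p₀ → n p = m p) := by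
  classical
  obtain ⟨s, hs, hc⟩ : ∃ s, s - r ∈ Imap v m ∧ b + (a - 1) * s ≠ 0 := by
    obtain ⟨x, hx, hxm⟩ := hv.exists_ne_zero_mem_Imap hm
    by_cases h : b + (a - 1) * r = 0
    · refine ⟨r + x, by simpa using hxm, fun h' => hba ?_⟩
      have hax : (a - 1) * x = 0 := by linear_combination h' - h
      have ha1 : a - 1 = 0 := (mul_eq_zero.mp hax).resolve_right hx
      rw [ha1, zero_mul, add_zero] at h
      rw [h, sub_eq_zero.mp ha1]
    · exact ⟨r, fun h0 => absurd (sub_self r) h0, h⟩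
  set c := b + (a - 1) * s with hc_def
  set n : ι → ℤ := fun p => if p ∈ F ∨ p = p₀ then
    max (max (m p) N) (max (v p₀ c + 1) (v p₀ c + 1 - v p₀ (-a))) else m p with hn_def
  have hmn : m ≤ n := by
    intro p
    simp only [hn_def]
    split_ifs
    · exact (le_max_left _ _).trans (le_max_left _ _)
    · exact le_rfl
  have hn₀ : n p₀ = max (max (m p₀) N) (max (v p₀ c + 1) (v p₀ c + 1 - v p₀ (-a))) :=
    if_pos (Or.inr rfl)
  refine ⟨s, n, ?_, ?_, ?_, ?_, ?_⟩
  · refine ((hm.union F.finite_toSet).union (Set.finite_singleton p₀)).subset fun p hp => ?_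
    by_contra hp'
    simp only [Set.mem_union, Set.mem_ofPred_eq, Finset.mem_coe, Set.mem_singleton_iff,
      not_or, not_not] at hp'
    exact hp ((if_neg (by tauto)).trans hp'.1.1)
  · rw [Set.eq_empty_iff_forall_notMem]
    rintro _ ⟨⟨x, hx, rfl⟩, y, hy, hxy⟩
    refine hv.add_mul_ne hc (neg_ne_zero.mpr ha) p₀ (by omega) (by omega) hx hy ?_
    rw [hc_def]
    linear_combination -hxy
  · rintro _ ⟨x, hx, rfl⟩
    exact ⟨(s - r) + x, hv.add_mem_Imap hs (Imap_antitone v hmn hx), by ring⟩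
  · intro q hq
    simp only [hn_def, hq, true_or, if_true]
    exact (le_max_right _ _).trans (le_max_left _ _)
  · intro p _ hpS hp
    exact if_neg (not_or.mpr ⟨fun hpF => hpS (hF hpF), hp⟩)
end

section
/- Let R be a countable Krull ring with field of fractions Q and essential valuations (v_p)_{p∈P}, and assume P_inf ≠ ∅ or P_fin is infinite. Let S ⊆ P_fin and let ((b_i,a_i))_{i≥1} be an enumeration of (Q × Q×) ∖ {(0,1)}. Then there exist a sequence (r_i)_{i≥1} in R and finitely supported functions m_i : P → ℕ such that, with I_i := I(m_i): (a) R ⊇ r_1+I_1 ⊇ r_2+I_2 ⊇ …; (b) (r_i+I_i) ∩ ((b_i + a_i r_i) + a_i I_i) = ∅ for all i; (c) for every q ∈ S, m_i(q) → ∞ as i → ∞; (d) for every p ∈ P_fin∖S, the sequence (m_i(p))_i is eventually constant. -/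
/-- `P_inf = P ∖ P_fin`. -/
def Pinf (R : Type*) {Q ι : Type*} [CommRing R] [Field Q] [Algebra R Q]
    (v : ι → Q → ℤ) : Set ι :=
  { p | p ∉ Pfin R v }

namespace IsKrullFamily

variable {R Q ι : Type*} [CommRing R] [Field Q] [Algebra R Q] {v : ι → Q → ℤ}

theorem map_one (hv : IsKrullFamily R v) (p : ι) : v p 1 = 0 := by
  have h := hv.2.1 p 1 1 one_ne_zero one_ne_zero
  rw [mul_one] at h
  omega

theorem map_neg (hv : IsKrullFamily R v) (p : ι) {x : Q} (hx : x ≠ 0) : v p (-x) = v p x := by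
  have h1 : (-1 : Q) ≠ 0 := neg_ne_zero.mpr one_ne_zero
  have h2 := hv.2.1 p (-1) (-1) h1 h1
  have h3 := hv.2.1 p (-1) x h1 hx
  rw [neg_mul_neg, one_mul, hv.map_one] at h2
  rw [neg_one_mul] at h3
  omega

theorem countable_index [Countable Q] (hv : IsKrullFamily R v) : Countable ι := by
  refine Set.countable_univ_iff.mp ((Set.countable_iUnion fun x : {x : Q // x ≠ 0} =>
    (hv.2.2.2.2.1 x x.2).countable).mono fun p _ => ?_)
  obtain ⟨x, hx, h⟩ := hv.1 p 1
  exact Set.mem_iUnion.mpr ⟨⟨x, hx⟩, by simp [h]⟩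

theorem add_mem_Imap_s12 (hv : IsKrullFamily R v) {m : ι → ℤ} {x y : Q} (hx : x ∈ Imap v m)
    (hy : y ∈ Imap v m) : x + y ∈ Imap v m := by
  intro hxy p
  rcases eq_or_ne x 0 with rfl | hx0
  · rw [zero_add] at hxy ⊢
    exact hy hxy p
  rcases eq_or_ne y 0 with rfl | hy0
  · rw [add_zero]
    exact hx hx0 p
  exact (le_min (hx hx0 p) (hy hy0 p)).trans (hv.2.2.1 p x y hx0 hy0 hxy)

theorem Imap_subset_range (hv : IsKrullFamily R v) (m : ι → ℕ) :
    Imap v (fun p => (m p : ℤ)) ⊆ Set.range (algebraMap R Q) := by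
  intro x hx
  rcases eq_or_ne x 0 with rfl | hx0
  · exact ⟨0, map_zero _⟩
  · exact (hv.2.2.2.1 x hx0).mpr fun p => (Int.natCast_nonneg _).trans (hx hx0 p)

theorem exists_ne_zero_mem_Imap_s12 (hv : IsKrullFamily R v) {m : ι → ℕ}
    (hm : {p | m p ≠ 0}.Finite) : ∃ x ∈ Imap v (fun p => (m p : ℤ)), x ≠ 0 := by
  obtain ⟨x, hx0, hx1, hx2⟩ := hv.2.2.2.2.2 hm.toFinset fun p => (m p : ℤ)
  refine ⟨x, fun _ p => ?_, hx0⟩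
  by_cases hp : p ∈ hm.toFinset
  · exact (hx1 p hp).ge
  · have h0 : m p = 0 := by simpa using hp
    simpa [h0] using hx2 p hp

/-- A coset `r + I` and its image under `z ↦ b + a * z` are disjoint as soon as some valuation
does not exceed the bound that it satisfies on `a * I + I` at `(1 - a) * r - b`. -/
theorem image_inter_image_eq_empty (hv : IsKrullFamily R v) {m : ι → ℤ} {a b r : Q} (ha : a ≠ 0)
    (hd : r - (b + a * r) ≠ 0) (p : ι) (h1 : v p (r - (b + a * r)) < m p)
    (h2 : v p (r - (b + a * r)) < v p a + m p) :
    ((fun x => r + x) '' Imap v m) ∩ ((fun x => (b + a * r) + a * x) '' Imap v m) = ∅ := by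
  rw [Set.eq_empty_iff_forall_notMem]
  rintro _ ⟨⟨x, hx, rfl⟩, y, hy, hxy⟩
  have hd' : r - (b + a * r) = a * y + -x := by linear_combination -hxy
  rw [hd'] at hd h1 h2
  rcases eq_or_ne x 0 with rfl | hx0 <;> rcases eq_or_ne y 0 with rfl | hy0
  · simp at hd
  · rw [neg_zero, add_zero, hv.2.1 p a y ha hy0] at h2
    linarith [hy hy0 p]
  · rw [mul_zero, zero_add, hv.map_neg p hx0] at h1
    linarith [hx hx0 p]
  · have h := hv.2.2.1 p (a * y) (-x) (mul_ne_zero ha hy0) (neg_ne_zero.mpr hx0) hd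
    rw [hv.map_neg p hx0, hv.2.1 p a y ha hy0] at h
    have := hx hx0 p
    have := hy hy0 p
    omega

/-- One may move a coset representative within `r + I(m)` to a point which is not fixed by a given
non-identity affine map. -/
theorem exists_add_not_fixed (hv : IsKrullFamily R v) {m : ι → ℕ} (hm : {p | m p ≠ 0}.Finite)
    {a b : Q} (hne : (b, a) ≠ ((0 : Q), (1 : Q))) (r : R) :
    ∃ r' : R, algebraMap R Q r' - algebraMap R Q r ∈ Imap v (fun p => (m p : ℤ)) ∧
      algebraMap R Q r' - (b + a * algebraMap R Q r') ≠ 0 := by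
  by_cases h : algebraMap R Q r - (b + a * algebraMap R Q r) = 0
  · obtain ⟨x, hx, hx0⟩ := hv.exists_ne_zero_mem_Imap_s12 hm
    obtain ⟨y, rfl⟩ := hv.Imap_subset_range m hx
    refine ⟨r + y, by simpa using hx, fun h' => hne ?_⟩
    rw [map_add] at h'
    have h1 : (1 - a) * algebraMap R Q y = 0 := by linear_combination h' - h
    have ha : a = 1 := by
      linear_combination -(mul_eq_zero.mp h1).resolve_right hx0
    subst ha
    have hb : b = 0 := by linear_combination -h
    rw [hb]
  · exact ⟨r, fun h0 => absurd (sub_self _) h0, h⟩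

/-- The inductive step: refine a coset `r + I(m)` so that it becomes disjoint from its image under
a given non-identity affine map, while `m` becomes at least `n` on a finite set `T` and, outside
`T ∪ U`, changes only where it vanished. -/
theorem exists_refinement (hv : IsKrullFamily R v) {U : Set ι} (hU : U.Nonempty ∨ Uᶜ.Infinite)
    {m : ι → ℕ} (hm : {p | m p ≠ 0}.Finite) {T : Set ι} (hT : T.Finite) (n : ℕ) {a b : Q}
    (ha : a ≠ 0) (hne : (b, a) ≠ ((0 : Q), (1 : Q))) (r : R) :
    ∃ (r' : R) (m' : ι → ℕ), {p | m' p ≠ 0}.Finite ∧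
      algebraMap R Q r' - algebraMap R Q r ∈ Imap v (fun p => (m p : ℤ)) ∧ m ≤ m' ∧
      ((fun x => algebraMap R Q r' + x) '' Imap v (fun p => (m' p : ℤ))) ∩
        ((fun x => (b + a * algebraMap R Q r') + a * x) '' Imap v (fun p => (m' p : ℤ))) = ∅ ∧
      (∀ q ∈ T, n ≤ m' q) ∧ ∀ p ∉ T ∪ U, m p ≠ 0 → m' p = m p := by
  classical
  obtain ⟨r', hr', hd⟩ := hv.exists_add_not_fixed hm hne r
  obtain ⟨p₀, hp₀⟩ : ∃ p₀, p₀ ∈ U ∨ m p₀ = 0 := by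
    rcases hU with ⟨p, hp⟩ | hU
    · exact ⟨p, Or.inl hp⟩
    · obtain ⟨p, -, hp⟩ := hU.exists_notMem_finite hm
      exact ⟨p, Or.inr (by simpa using hp)⟩
  obtain ⟨k, hk1, hk2⟩ : ∃ k : ℕ, v p₀ (algebraMap R Q r' - (b + a * algebraMap R Q r')) < k ∧
      v p₀ (algebraMap R Q r' - (b + a * algebraMap R Q r')) < v p₀ a + k :=
    ⟨(v p₀ (algebraMap R Q r' - (b + a * algebraMap R Q r'))).natAbs + (v p₀ a).natAbs + 1,
      by omega, by omega⟩
  let m' : ι → ℕ := fun p => max (m p) (max (if p = p₀ then k else 0) (if p ∈ T then n else 0))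
  have hk : k ≤ m' p₀ := by simp [m']
  refine ⟨r', m', ?_, hr', fun p => le_max_left _ _, ?_, fun q hq => by simp [m', hq], ?_⟩
  · refine ((hm.union (Set.finite_singleton p₀)).union hT).subset fun p hp => ?_
    by_contra h
    simp only [Set.mem_union, Set.mem_ofPred_eq, Set.mem_singleton_iff, not_or, not_not] at h
    exact hp (by simp [m', h])
  · exact hv.image_inter_image_eq_empty ha hd p₀ (by omega) (by omega)
  · intro p hp hmp
    rw [Set.mem_union, not_or] at hp
    have hpp : p ≠ p₀ := by
      rintro rfl
      exact hp₀.elim hp.2 hmp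
    simp [m', hp.1, hpp]

end IsKrullFamily

/-- Let `R` be a countable Krull ring with `P_inf ≠ ∅` or `P_fin` infinite,
let `S ⊆ P_fin`, and let `((b_i, a_i))_i` be an enumeration of
`(Q × Q×) ∖ {(0,1)}`. Then there are `r_i ∈ R` and finitely supported
`m_i : P → ℕ` such that, with `I_i = I(m_i)`:
(a) `R ⊇ r_0 + I_0 ⊇ r_1 + I_1 ⊇ ⋯`;
(b) `(r_i + I_i) ∩ ((b_i + a_i r_i) + a_i I_i) = ∅` for all `i`;
(c) for every `q ∈ S`, `m_i(q) → ∞`;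
(d) for every `p ∈ P_fin ∖ S`, the sequence `(m_i(p))_i` is eventually
constant. -/
theorem exists_trivial_stabilizer_chain (R Q ι : Type*) [CommRing R] [IsDomain R]
    [Countable R] [Field Q] [Algebra R Q] [IsFractionRing R Q]
    (v : ι → Q → ℤ) (hv : IsKrullFamily R v)
    (hP : (Pinf R v).Nonempty ∨ (Pfin R v).Infinite)
    (S : Set ι) (hS : S ⊆ Pfin R v)
    (b a : ℕ → Q) (ha : ∀ i, a i ≠ 0) (hne : ∀ i, (b i, a i) ≠ ((0 : Q), (1 : Q)))
    (hinj : Function.Injective fun i => (b i, a i))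
    (hsurj : ∀ x w : Q, w ≠ 0 → (x, w) ≠ ((0 : Q), (1 : Q)) → ∃ i, b i = x ∧ a i = w) :
    ∃ (r : ℕ → R) (m : ℕ → ι → ℕ),
      (∀ i, { p | m i p ≠ 0 }.Finite) ∧
      ((fun x => algebraMap R Q (r 0) + x) '' Imap v (fun p => (m 0 p : ℤ))
        ⊆ Set.range (algebraMap R Q)) ∧
      (∀ i, (fun x => algebraMap R Q (r (i + 1)) + x) '' Imap v (fun p => (m (i + 1) p : ℤ))
        ⊆ (fun x => algebraMap R Q (r i) + x) '' Imap v (fun p => (m i p : ℤ))) ∧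
      (∀ i, ((fun x => algebraMap R Q (r i) + x) '' Imap v (fun p => (m i p : ℤ))) ∩
        ((fun x => (b i + a i * algebraMap R Q (r i)) + a i * x) ''
          Imap v (fun p => (m i p : ℤ))) = ∅) ∧
      (∀ q ∈ S, ∀ N : ℕ, ∃ i₀ : ℕ, ∀ i ≥ i₀, N ≤ m i q) ∧
      (∀ p ∈ Pfin R v \ S, ∃ (i₀ : ℕ) (c : ℕ), ∀ i ≥ i₀, m i p = c) := by
  have : Countable Q := (IsLocalization.mk'_surjective (nonZeroDivisors R) (S := Q)).countable
  have := hv.countable_index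
  obtain ⟨e, he⟩ := exists_injective_nat ι
  have hU : (Pinf R v).Nonempty ∨ (Pinf R v)ᶜ.Infinite := by
    have hc : (Pinf R v)ᶜ = Pfin R v := compl_compl (Pfin R v)
    rwa [hc]
  have hT (n : ℕ) : {q | q ∈ S ∧ e q ≤ n}.Finite :=
    ((Set.finite_Iic n).preimage he.injOn).subset fun _ hq => hq.2
  choose f g hfin hmem hmono hdisj hge hconst using
    fun (i : ℕ) (s : R × {m : ι → ℕ // {p | m p ≠ 0}.Finite}) =>
      hv.exists_refinement hU s.2.2 (hT i) i (ha i) (hne i) s.1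
  let s : ℕ → R × {m : ι → ℕ // {p | m p ≠ 0}.Finite} :=
    Nat.rec (0, ⟨0, by simp⟩) fun i s => (f i s, ⟨g i s, hfin i s⟩)
  refine ⟨fun i => f i (s i), fun i => g i (s i), fun i => hfin i (s i), ?_, fun i => ?_,
    fun i => hdisj i (s i), fun q hq N => ⟨max (e q) N, fun i hi => ?_⟩, fun p hp => ?_⟩
  · rintro _ ⟨x, hx, rfl⟩
    obtain ⟨y, rfl⟩ := hv.Imap_subset_range _ hx
    exact ⟨f 0 (s 0) + y, map_add _ _ _⟩
  · rintro _ ⟨x, hx, rfl⟩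
    refine ⟨_, hv.add_mem_Imap_s12 (hmem (i + 1) (s (i + 1))) (y := x) fun hx0 p => ?_, ?_⟩
    · exact (Int.ofNat_le.mpr (hmono (i + 1) (s (i + 1)) p)).trans (hx hx0 p)
    · change algebraMap R Q (f i (s i)) +
        (algebraMap R Q (f (i + 1) (s (i + 1))) - algebraMap R Q (f i (s i)) + x) = _
      ring
  · exact (le_of_max_le_right hi).trans (hge i (s i) q ⟨hq, le_of_max_le_left hi⟩)
  · by_cases h : ∃ i, g i (s i) p ≠ 0
    · obtain ⟨i₀, h0⟩ := h
      refine ⟨i₀, g i₀ (s i₀) p, fun i hi => ?_⟩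
      induction i, hi using Nat.le_induction with
      | base => rfl
      | succ i hi ih =>
        have hpU : p ∉ {q | q ∈ S ∧ e q ≤ i + 1} ∪ Pinf R v := by
          rintro (h | h)
          · exact hp.2 h.1
          · exact h hp.1
        exact (hconst (i + 1) (s (i + 1)) p hpU (ih.trans_ne h0)).trans ih
    · push Not at h
      exact ⟨0, 0, fun i _ => h i⟩
end

section
/- Let R be an integral domain which is not a field and whose Jacobson radical is (0). Let I ∈ I(R), let m ≥ 1, and let (b_i,a_i), (b'_i,a'_i) ∈ R × R× with (b_i,a_i) ≠ (b'_i,a'_i) for all 1 ≤ i ≤ m. Then there exist b ∈ R, a ∈ R×, c ∈ R× and r₁, r₂ ∈ R such that: (1) b ∈ I; (2) (b'_i−b_i)+(a'_i−a_i)b ≠ 0 for all 1 ≤ i ≤ m; (3) a ∈ 1+I; (4) (b'_i−b_i)+(a'_i−a_i)b ∉ aR for all 1 ≤ i ≤ m; (5) c ∉ R* and c ∈ 1+I; (6) r₁, r₂ ∈ I and r₁ + cR ≠ r₂ + cR. -/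
/-- A constructible ideal contains all multiples of some nonzero element. -/
theorem exists_ne_zero_forall_mul_mem_of_mem_cI {R : Type*} [CommRing R] [IsDomain R]
    {I : Set R} (hI : I ∈ cI R) : ∃ e : R, e ≠ 0 ∧ ∀ r, e * r ∈ I := by
  obtain ⟨n, a, c, ha, -, rfl⟩ := hI
  refine ⟨∏ i, a i, Finset.prod_ne_zero_iff.mpr fun i _ => ha i, fun r i => ?_⟩
  exact ((Finset.dvd_prod_of_mem a (Finset.mem_univ i)).mul_right r).mul_left c

/-- Finitely many nonzero affine functions on an infinite domain have a common non-root. -/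
theorem exists_forall_add_mul_ne_zero {R ι : Type*} [CommRing R] [IsDomain R] [Infinite R]
    [Finite ι] (β α : ι → R) (h : ∀ i, β i ≠ 0 ∨ α i ≠ 0) :
    ∃ r, ∀ i, β i + α i * r ≠ 0 := by
  have hfin : (⋃ i, {r | β i + α i * r = 0}).Finite := by
    refine Set.finite_iUnion fun i => Set.Subsingleton.finite fun x hx y hy => ?_
    simp only [Set.mem_ofPred_eq] at hx hy
    by_cases hα : α i = 0
    · exact absurd hα ((h i).resolve_left (not_not.mpr (by simpa [hα] using hx)))
    · exact mul_left_cancel₀ hα (add_left_cancel (hx.trans hy.symm))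
  obtain ⟨r, hr⟩ := hfin.exists_notMem
  exact ⟨r, by simpa using hr⟩

/-- If the Jacobson radical of a domain that is not a field vanishes, then every nonzero `p`
has a multiple `p * y` such that `1 + p * y` is neither zero nor a unit. -/
theorem exists_one_add_mul_ne_zero_not_isUnit {R : Type*} [CommRing R] [IsDomain R]
    (hnf : ¬IsField R) (hJ : Ideal.jacobson (⊥ : Ideal R) = ⊥) {p : R} (hp : p ≠ 0) :
    ∃ y, 1 + p * y ≠ 0 ∧ ¬IsUnit (1 + p * y) := by
  obtain ⟨w, hw0, hw⟩ := Ring.exists_not_isUnit_of_not_isField hnf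
  have hmem : p * w ∉ Ideal.jacobson (⊥ : Ideal R) := by
    rw [hJ]
    exact mul_ne_zero hp hw0
  rw [Ideal.mem_jacobson_bot, not_forall] at hmem
  obtain ⟨y, hy⟩ := hmem
  refine ⟨w * y, fun h0 => hw (IsUnit.of_mul_eq_one (-(p * y)) ?_), fun hu => hy ?_⟩
  · linear_combination -h0
  · convert hu using 1
    ring

/-- Let `R` be an integral domain which is not a field and whose Jacobson
radical is `(0)`. Given `I ∈ I(R)` and `(bᵢ, aᵢ) ≠ (b'ᵢ, a'ᵢ)` in `R ⋊ R×`
for `1 ≤ i ≤ m`, there exist `b ∈ R`, `a, c ∈ R×` and `r₁, r₂ ∈ R` with: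
(1) `b ∈ I`; (2) `(b'ᵢ−bᵢ)+(a'ᵢ−aᵢ)b ≠ 0` for all `i`; (3) `a ∈ 1+I`;
(4) `(b'ᵢ−bᵢ)+(a'ᵢ−aᵢ)b ∉ aR` for all `i`; (5) `c ∉ R*` and `c ∈ 1+I`;
(6) `r₁, r₂ ∈ I` and `r₁ + cR ≠ r₂ + cR`. -/
theorem pure_infiniteness_criterion (R : Type*) [CommRing R] [IsDomain R]
    (hnf : ¬IsField R) (hJ : Ideal.jacobson (⊥ : Ideal R) = ⊥)
    (I : Set R) (hI : I ∈ cI R) (m : ℕ)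
    (bs as bs' as' : Fin (m + 1) → R)
    (has : ∀ i, as i ≠ 0) (has' : ∀ i, as' i ≠ 0)
    (hne : ∀ i, (bs i, as i) ≠ (bs' i, as' i)) :
    ∃ (b aa c r₁ r₂ : R), aa ≠ 0 ∧ c ≠ 0 ∧
      b ∈ I ∧
      (∀ i, (bs' i - bs i) + (as' i - as i) * b ≠ 0) ∧
      aa ∈ (fun x => 1 + x) '' I ∧
      (∀ i, (bs' i - bs i) + (as' i - as i) * b ∉ Set.range fun x => aa * x) ∧
      (¬IsUnit c ∧ c ∈ (fun x => 1 + x) '' I) ∧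
      (r₁ ∈ I ∧ r₂ ∈ I ∧
        ((fun x => r₁ + c * x) '' Set.univ ≠ (fun x => r₂ + c * x) '' Set.univ)) := by
  obtain ⟨e, he, heI⟩ := exists_ne_zero_forall_mul_mem_of_mem_cI hI
  have : Infinite R := by
    by_contra hfin
    rw [not_infinite_iff_finite] at hfin
    exact hnf (Finite.isField_of_domain R)
  obtain ⟨r, hr⟩ := exists_forall_add_mul_ne_zero (fun i => bs' i - bs i)
    (fun i => (as' i - as i) * e) fun i => by
      by_contra! h
      have h2 := (mul_eq_zero.mp h.2).resolve_right he
      exact hne i (Prod.ext (sub_eq_zero.mp h.1).symm (sub_eq_zero.mp h2).symm)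
  simp only [mul_assoc] at hr
  set d : Fin (m + 1) → R := fun i => (bs' i - bs i) + (as' i - as i) * (e * r) with hd
  obtain ⟨y, hu0, hu⟩ := exists_one_add_mul_ne_zero_not_isUnit hnf hJ
    (mul_ne_zero he (Finset.prod_ne_zero_iff.mpr fun i _ => hr i : ∏ i, d i ≠ 0))
  set u := 1 + e * (∏ i, d i) * y with hudef
  have hndvd : ∀ x, x ∣ e * ∏ i, d i → ¬u ∣ x := fun x hx hux =>
    hu (isUnit_of_dvd_one ((dvd_add_left ((hux.trans hx).mul_right y)).mp (hudef ▸ dvd_rfl)))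
  have huI : u ∈ (fun x => 1 + x) '' I := ⟨e * ((∏ i, d i) * y), heI _, by
    simp only [hudef, mul_assoc]⟩
  refine ⟨e * r, u, u, 0, e, hu0, hu0, heI r, hr, huI, ?_, ⟨hu, huI⟩, ?_, ?_, ?_⟩
  · rintro i ⟨x, hx⟩
    exact hndvd (d i) ((Finset.dvd_prod_of_mem d (Finset.mem_univ i)).mul_left e) ⟨x, hx.symm⟩
  · simpa using heI 0
  · simpa using heI 1
  · intro h
    have hmem : e ∈ (fun x => 0 + u * x) '' Set.univ := h ▸ ⟨0, trivial, by simp⟩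
    obtain ⟨x, -, hx⟩ := hmem
    exact hndvd e (dvd_mul_right _ _) ⟨x, by simpa using hx.symm⟩
end

section
/- The ring R = ℤ[√−3] = { x + y√−3 : x, y ∈ ℤ } does not satisfy the independence condition: there exist I, I₁, …, Iₙ ∈ I(R) with I = I₁ ∪ … ∪ Iₙ but I ≠ Iᵢ for all 1 ≤ i ≤ n. -/
/-- Preimages under multiplication by `c` of principal ideals are constructible. -/
theorem setOf_dvd_mul_mem_cI {R : Type*} [CommRing R] {a c : R} (ha : a ≠ 0) (hc : c ≠ 0) :
    {r : R | a ∣ c * r} ∈ cI R :=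
  ⟨0, fun _ => a, c, fun _ => ha, hc, by ext r; simp [Dvd.dvd]⟩

namespace Zsqrtd

theorem one_add_sqrtd_dvd_iff (r : Zsqrtd (-3)) :
    (⟨1, 1⟩ : Zsqrtd (-3)) ∣ r ↔ 4 ∣ r.im - r.re := by
  constructor
  · rintro ⟨t, rfl⟩
    simp only [re_mul, im_mul]
    omega
  · rintro ⟨k, hk⟩
    refine ⟨⟨r.im - k, k⟩, ?_⟩
    ext <;> simp only [re_mul, im_mul] <;> omega

theorem one_sub_sqrtd_dvd_iff (r : Zsqrtd (-3)) :
    (⟨1, -1⟩ : Zsqrtd (-3)) ∣ r ↔ 4 ∣ r.im + r.re := by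
  constructor
  · rintro ⟨t, rfl⟩
    simp only [re_mul, im_mul]
    omega
  · rintro ⟨k, hk⟩
    refine ⟨⟨k - r.im, k⟩, ?_⟩
    ext <;> simp only [re_mul, im_mul] <;> omega

theorem two_dvd_iff {d : ℤ} (r : Zsqrtd d) : (2 : Zsqrtd d) ∣ r ↔ 2 ∣ r.re ∧ 2 ∣ r.im := by
  simpa using intCast_dvd 2 r

end Zsqrtd

open Zsqrtd in
/-- The ring `R = ℤ[√−3]` does not satisfy the independence condition: there
are `I, I₁, …, Iₙ ∈ I(R)` with `I = I₁ ∪ … ∪ Iₙ` but `I ≠ Iᵢ` for all `i`. -/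
theorem zsqrtd_neg_three_not_independent :
    ∃ (I : Set (Zsqrtd (-3))) (n : ℕ) (Is : Fin (n + 1) → Set (Zsqrtd (-3))),
      I ∈ cI (Zsqrtd (-3)) ∧ (∀ i, Is i ∈ cI (Zsqrtd (-3))) ∧
      I = ⋃ i, Is i ∧ ∀ i, I ≠ Is i := by
  have h2 : (2 : Zsqrtd (-3)) ≠ 0 := by simp
  have hadd : (⟨1, 1⟩ : Zsqrtd (-3)) ≠ 0 := by simp [Zsqrtd.ext_iff]
  have hsub : (⟨1, -1⟩ : Zsqrtd (-3)) ≠ 0 := by simp [Zsqrtd.ext_iff]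
  have hI (r : Zsqrtd (-3)) : (⟨1, 1⟩ : Zsqrtd (-3)) ∣ 2 * r ↔ 2 ∣ r.im - r.re := by
    rw [one_add_sqrtd_dvd_iff]
    simp only [re_mul, im_mul, re_ofNat, im_ofNat]
    omega
  refine ⟨{r | ⟨1, 1⟩ ∣ 2 * r}, 2,
    ![{r | 2 ∣ 1 * r}, {r | ⟨1, 1⟩ ∣ 1 * r}, {r | ⟨1, -1⟩ ∣ 1 * r}],
    setOf_dvd_mul_mem_cI hadd h2, ?_, ?_, ?_⟩
  · simp only [Fin.forall_fin_succ, IsEmpty.forall_iff, and_true]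
    exact ⟨setOf_dvd_mul_mem_cI h2 one_ne_zero, setOf_dvd_mul_mem_cI hadd one_ne_zero,
      setOf_dvd_mul_mem_cI hsub one_ne_zero⟩
  · ext r
    simp only [Set.mem_iUnion, Fin.exists_fin_succ, IsEmpty.exists_iff, or_false]
    change ⟨1, 1⟩ ∣ 2 * r ↔ 2 ∣ 1 * r ∨ ⟨1, 1⟩ ∣ 1 * r ∨ ⟨1, -1⟩ ∣ 1 * r
    rw [one_mul, hI, two_dvd_iff, one_add_sqrtd_dvd_iff, one_sub_sqrtd_dvd_iff]
    omega
  · simp only [Fin.forall_fin_succ, IsEmpty.forall_iff, and_true]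
    refine ⟨fun h => ?_, fun h => ?_, fun h => ?_⟩
    · have : (2 : Zsqrtd (-3)) ∣ 1 * ⟨1, 1⟩ :=
        (Set.ext_iff.mp h ⟨1, 1⟩).mp ((hI _).mpr (by simp))
      rw [one_mul, two_dvd_iff] at this
      norm_num at this
    · have : (⟨1, 1⟩ : Zsqrtd (-3)) ∣ 1 * 2 :=
        (Set.ext_iff.mp h 2).mp ((hI _).mpr (by simp))
      rw [one_mul, one_add_sqrtd_dvd_iff] at this
      norm_num at this
    · have : (⟨1, -1⟩ : Zsqrtd (-3)) ∣ 1 * 2 :=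
        (Set.ext_iff.mp h 2).mp ((hI _).mpr (by simp))
      rw [one_mul, one_sub_sqrtd_dvd_iff] at this
      norm_num at this
end
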